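/- arXiv:2210.01949 — 10 statements merged into one kernel-verified Lean document; each statement's English description precedes it below -/
import Mathlib

section
/- For every real number x, the family of factors ((j − i)/(j + i)) · ((x − j − i)/(x − j + i)), indexed by j ∈ ℤ, is multipliable, and its product satisfies ∏_{j ∈ ℤ} ((j − i)/(j + i)) · ((x − j − i)/(x − j + i)) = sin(π(i − x)) / sin(π(i + x)), where sin is the complex sine function and i is the imaginary unit. -/
open Real

open Filter Topology Complex in
/-- The shifted linear factors at `z` and `w` have summable inverse products over `ℤ`. -/
lemma summable_inv_int_add_mul_inv_int_add (z w : ℂ) :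
    Summable fun j : ℤ => ((j : ℂ) + z)⁻¹ * ((j : ℂ) + w)⁻¹ := by
  have h (z : ℂ) := EisensteinSeries.linear_inv_isBigO_right 1 z
  have hs : Summable fun n : ℤ => (n : ℝ)⁻¹ * (n : ℝ)⁻¹ := by
    have := Real.summable_one_div_int_pow (p := 2) |>.mpr one_lt_two
    refine this.congr fun n => ?_
    rw [one_div, sq, mul_inv]
  refine summable_of_isBigO hs (((h z).mul (h w)).congr_left fun j => ?_)
  simp [add_comm]

lemma real_add_I_mem_integerComplement (x : ℝ) :
    (x : ℂ) + Complex.I ∈ Complex.integerComplement := by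
  rintro ⟨n, hn⟩
  simpa using congrArg Complex.im hn

lemma int_add_I_ne_zero (j : ℤ) : (j : ℂ) + Complex.I ≠ 0 := fun h => by
  simpa using congrArg Complex.im h

lemma real_sub_int_add_I_ne_zero (x : ℝ) (j : ℤ) : (x : ℂ) - j + Complex.I ≠ 0 := fun h => by
  simpa using congrArg Complex.im h

lemma multipliable_blaschke_factors (x : ℝ) :
    Multipliable (fun j : ℤ => (((j : ℂ) - Complex.I) / ((j : ℂ) + Complex.I)) *
      (((x : ℂ) - j - Complex.I) / ((x : ℂ) - j + Complex.I))) := by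
  have hs : Summable fun j : ℤ => ‖2 * Complex.I * x *
      (((j : ℂ) + Complex.I)⁻¹ * ((j : ℂ) + (-x - Complex.I))⁻¹)‖ :=
    ((summable_inv_int_add_mul_inv_int_add _ _).mul_left _).norm
  refine (multipliable_one_add_of_summable hs).congr fun j => ?_
  have h₁ := int_add_I_ne_zero j
  have h₂ := real_sub_int_add_I_ne_zero x j
  have h₃ : (j : ℂ) + (-x - Complex.I) = -((x : ℂ) - j + Complex.I) := by ring
  rw [h₃]
  field_simp
  ring

open Filter Topology in
theorem tendsto_prod_blaschke_pairs (x : ℝ) :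
    Tendsto (fun n : ℕ => ∏ k ∈ Finset.range n,
      ((1 + sineTerm ((x : ℂ) - Complex.I) k) / (1 + sineTerm ((x : ℂ) + Complex.I) k))) atTop
      (𝓝 ((Complex.sin (π * (x - Complex.I)) / (π * (x - Complex.I))) /
        (Complex.sin (π * (x + Complex.I)) / (π * (x + Complex.I))))) := by
  have hb := real_add_I_mem_integerComplement x
  have ha : (x : ℂ) - Complex.I ≠ 0 := fun h => by simpa using congrArg Complex.im h
  have hb0 := Complex.integerComplement.ne_zero hb
  simp_rw [Finset.prod_div_distrib]
  refine (tendsto_euler_sin_prod' ha).div (tendsto_euler_sin_prod' hb0) ?_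
  have hπ : (π : ℂ) ≠ 0 := by exact_mod_cast Real.pi_ne_zero
  exact div_ne_zero (sin_pi_mul_ne_zero hb) (mul_ne_zero hπ hb0)

/-- For every real `x`, the Blaschke factors over `j ∈ ℤ` with zeros
`j + i` are multipliable and their product equals `sin(π(i − x)) / sin(π(i + x))`. -/
theorem blaschke_product_eq_sine_ratio (x : ℝ) :
    Multipliable (fun j : ℤ => (((j : ℂ) - Complex.I) / ((j : ℂ) + Complex.I)) *
      (((x : ℂ) - j - Complex.I) / ((x : ℂ) - j + Complex.I))) ∧
    ∏' j : ℤ, (((j : ℂ) - Complex.I) / ((j : ℂ) + Complex.I)) *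
        (((x : ℂ) - j - Complex.I) / ((x : ℂ) - j + Complex.I)) =
      Complex.sin (π * (Complex.I - x)) / Complex.sin (π * (Complex.I + x)) := by
  have hm := multipliable_blaschke_factors x
  refine ⟨hm, ?_⟩
  have hb := real_add_I_mem_integerComplement x
  have hb0 := Complex.integerComplement.ne_zero hb
  have ha0 : (x : ℂ) - Complex.I ≠ 0 := fun h => by simpa using congrArg Complex.im h
  have hsin := sin_pi_mul_ne_zero hb
  have hπ : (π : ℂ) ≠ 0 := by exact_mod_cast Real.pi_ne_zero
  have hpair (k : ℕ) :
      (1 + sineTerm ((x : ℂ) - Complex.I) k) / (1 + sineTerm ((x : ℂ) + Complex.I) k) =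
      ((((k + 1 : ℕ) : ℤ) : ℂ) - Complex.I) / ((((k + 1 : ℕ) : ℤ) : ℂ) + Complex.I) *
        (((x : ℂ) - ((k + 1 : ℕ) : ℤ) - Complex.I) / ((x : ℂ) - ((k + 1 : ℕ) : ℤ) + Complex.I)) *
      ((((-((k + 1 : ℕ) : ℤ) : ℤ) : ℂ) - Complex.I) /
          (((-((k + 1 : ℕ) : ℤ) : ℤ) : ℂ) + Complex.I) *
        (((x : ℂ) - (-((k + 1 : ℕ) : ℤ) : ℤ) - Complex.I) /
          ((x : ℂ) - (-((k + 1 : ℕ) : ℤ) : ℤ) + Complex.I))) := by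
    have h₁ := int_add_I_ne_zero ((k + 1 : ℕ) : ℤ)
    have h₂ := int_add_I_ne_zero (-((k + 1 : ℕ) : ℤ))
    have h₃ := real_sub_int_add_I_ne_zero x ((k + 1 : ℕ) : ℤ)
    have h₄ := real_sub_int_add_I_ne_zero x (-((k + 1 : ℕ) : ℤ))
    have h₅ := sineTerm_ne_zero hb k
    have h₆ : (k : ℂ) + 1 ≠ 0 := Nat.cast_add_one_ne_zero k
    simp only [sineTerm] at h₅ ⊢
    push_cast at h₁ h₂ h₃ h₄ ⊢
    generalize (k : ℂ) + 1 = m at *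
    rw [div_mul_div_comm, div_mul_div_comm, div_mul_div_comm, div_eq_div_iff h₅
      (mul_ne_zero (mul_ne_zero h₁ h₃) (mul_ne_zero h₂ h₄))]
    field_simp
    ring
  have hlim := (hm.hasProd.nat_mul_neg.tendsto_prod_nat.comp (Filter.tendsto_add_atTop_nat 1))
  have hlim' := (tendsto_prod_blaschke_pairs x).mul_const
    (((0 - Complex.I) / (0 + Complex.I) * ((x - 0 - Complex.I) / (x - 0 + Complex.I))) ^ 2)
  have key := tendsto_nhds_unique hlim (hlim'.congr fun n => by
    rw [Function.comp_apply, Finset.prod_range_succ']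
    simp only [hpair]
    simp [sq])
  have hI : -Complex.I / Complex.I = -1 := by rw [neg_div, div_self Complex.I_ne_zero]
  simp only [Int.cast_zero, zero_sub, zero_add, sub_zero, hI] at key
  rw [show (π : ℂ) * (Complex.I - x) = -(π * (x - Complex.I)) by ring, Complex.sin_neg,
    add_comm Complex.I]
  have hc : -1 * (((x : ℂ) - Complex.I) / (x + Complex.I)) ≠ 0 :=
    mul_ne_zero (by norm_num) (div_ne_zero ha0 hb0)
  refine mul_right_cancel₀ hc (key.trans ?_)
  field_simp
end

section
/- For every integer n and every real number x, the family of factors ((j − i)/(j + i)) · ((x − j − i)/(x − j + i)), indexed by integers j ≤ n, is multipliable, and its product satisfies ∏_{j ≤ n} ((j − i)/(j + i)) · ((x − j − i)/(x − j + i)) = (Γ(−i − n)/Γ(i − n)) · (Γ(x − n + i)/Γ(x − n − i)), where Γ is the complex Gamma function and i the imaginary unit. -/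
open Real

/-- The factors `(a + k)(c + k) / ((b + k)(d + k))` with `a + c = b + d` are multipliable. -/
theorem multipliable_add_natCast_div {a b c d : ℂ} (h : a + c = b + d)
    (hb : ∀ k : ℕ, b + k ≠ 0) (hd : ∀ k : ℕ, d + k ≠ 0) :
    Multipliable (fun k : ℕ => ((a + k) / (b + k)) * ((c + k) / (d + k))) := by
  have key : ∀ k : ℕ, ((a + k) / (b + k)) * ((c + k) / (d + k)) =
      1 + (a * c - b * d) * ((b + k) * (d + k))⁻¹ := by
    intro k
    have h₁ := hb k
    have h₂ := hd k
    field_simp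
    linear_combination (k : ℂ) * h
  simp_rw [key]
  apply multipliable_one_add_of_summable
  apply Summable.norm
  apply Summable.mul_left
  refine summable_of_isBigO_nat (g := fun k : ℕ => 1 / (k : ℝ) ^ 2)
    (Real.summable_one_div_nat_pow.mpr one_lt_two) ?_
  have lim := (tendsto_natCast_div_add_atTop b).mul (tendsto_natCast_div_add_atTop d)
  have hO : (fun k : ℕ => ((b + k) * (d + k))⁻¹) =O[Filter.atTop]
      fun k : ℕ => 1 / (k : ℂ) ^ 2 := by
    refine Asymptotics.isBigO_of_div_tendsto_nhds ?_ _ (lim.congr fun k => ?_)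
    · filter_upwards [Filter.eventually_ne_atTop 0] with k hk h0
      simp [hk] at h0
    · simp only [Pi.div_apply, div_eq_mul_inv, inv_inv, mul_inv, add_comm (k : ℂ)]
      ring
  refine hO.trans (Asymptotics.IsBigO.of_norm_left ?_)
  simpa using Asymptotics.isBigO_refl (fun k : ℕ => ((k : ℝ) ^ 2)⁻¹) Filter.atTop

/-- Evaluation of `∏ (a + k)(c + k) / ((b + k)(d + k))`, where `a + c = b + d`, by Euler's limit
formula for the Gamma function. -/
theorem hasProd_add_natCast_div {a b c d : ℂ} (h : a + c = b + d)
    (ha : ∀ k : ℕ, a + k ≠ 0) (hb : ∀ k : ℕ, b + k ≠ 0)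
    (hc : ∀ k : ℕ, c + k ≠ 0) (hd : ∀ k : ℕ, d + k ≠ 0) :
    HasProd (fun k : ℕ => ((a + k) / (b + k)) * ((c + k) / (d + k)))
      ((Complex.Gamma b / Complex.Gamma a) * (Complex.Gamma d / Complex.Gamma c)) := by
  have hm := multipliable_add_natCast_div h hb hd
  have hΓ : ∀ {s : ℂ}, (∀ k : ℕ, s + k ≠ 0) → Complex.Gamma s ≠ 0 := fun hs =>
    Complex.Gamma_ne_zero fun k hk => hs k (by rw [hk]; ring)
  have lim := ((Complex.GammaSeq_tendsto_Gamma b).div (Complex.GammaSeq_tendsto_Gamma a)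
    (hΓ ha)).mul ((Complex.GammaSeq_tendsto_Gamma d).div (Complex.GammaSeq_tendsto_Gamma c)
    (hΓ hc))
  have lim' := hm.hasProd.tendsto_prod_nat.comp (Filter.tendsto_add_atTop_nat 1)
  have heq := tendsto_nhds_unique_of_eventuallyEq lim' lim ?_
  · exact heq ▸ hm.hasProd
  filter_upwards [Filter.eventually_ne_atTop 0] with N hN
  have hN' : (N : ℂ) ≠ 0 := Nat.cast_ne_zero.mpr hN
  have hpow : (N : ℂ) ^ a * (N : ℂ) ^ c = (N : ℂ) ^ b * (N : ℂ) ^ d := by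
    rw [← Complex.cpow_add _ _ hN', ← Complex.cpow_add _ _ hN', h]
  have hprod : ∀ {s : ℂ}, (∀ k : ℕ, s + k ≠ 0) → ∏ j ∈ Finset.range (N + 1), (s + j) ≠ 0 :=
    fun hs => Finset.prod_ne_zero_iff.mpr fun k _ => hs k
  have hA := hprod ha
  have hB := hprod hb
  have hC := hprod hc
  have hD := hprod hd
  have ne : ∀ s : ℂ, (N : ℂ) ^ s ≠ 0 := fun s => by simp [Complex.cpow_eq_zero_iff, hN]
  have hna := ne a
  have hnc := ne c
  have hf : (N.factorial : ℂ) ≠ 0 := Nat.cast_ne_zero.mpr N.factorial_ne_zero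
  simp only [Function.comp_apply, Pi.div_apply, Complex.GammaSeq, Finset.prod_mul_distrib,
    Finset.prod_div_distrib]
  generalize ∏ j ∈ Finset.range (N + 1), (a + j) = A at *
  generalize ∏ j ∈ Finset.range (N + 1), (b + j) = B at *
  generalize ∏ j ∈ Finset.range (N + 1), (c + j) = C at *
  generalize ∏ j ∈ Finset.range (N + 1), (d + j) = D at *
  generalize (N : ℂ) ^ a = p at *
  generalize (N : ℂ) ^ b = q at *
  generalize (N : ℂ) ^ c = r at *
  generalize (N : ℂ) ^ d = s at *
  field_simp
  linear_combination hpow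

/-- The natural numbers enumerate the integers `j ≤ n` in decreasing order. -/
def natEquivIntLE (n : ℤ) : ℕ ≃ {j : ℤ // j ≤ n} where
  toFun k := ⟨n - k, by lia⟩
  invFun j := (n - j).toNat
  left_inv k := by simp
  right_inv j := Subtype.ext (by have := j.2; dsimp only; lia)

/-- For every integer `n` and real `x`, the Blaschke factors over the
integers `j ≤ n` are multipliable and their product is expressed by Gamma functions:
`∏_{j ≤ n} ((j−i)/(j+i))·((x−j−i)/(x−j+i)) = (Γ(−i−n)/Γ(i−n))·(Γ(x−n+i)/Γ(x−n−i))`. -/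
theorem blaschke_partial_product_eq_gamma_ratio (n : ℤ) (x : ℝ) :
    Multipliable (fun j : {j : ℤ // j ≤ n} =>
      ((((j : ℤ) : ℂ) - Complex.I) / (((j : ℤ) : ℂ) + Complex.I)) *
      (((x : ℂ) - ((j : ℤ) : ℂ) - Complex.I) / ((x : ℂ) - ((j : ℤ) : ℂ) + Complex.I))) ∧
    ∏' j : {j : ℤ // j ≤ n},
        ((((j : ℤ) : ℂ) - Complex.I) / (((j : ℤ) : ℂ) + Complex.I)) *
        (((x : ℂ) - ((j : ℤ) : ℂ) - Complex.I) / ((x : ℂ) - ((j : ℤ) : ℂ) + Complex.I)) =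
      (Complex.Gamma (-Complex.I - n) / Complex.Gamma (Complex.I - n)) *
        (Complex.Gamma ((x : ℂ) - n + Complex.I) / Complex.Gamma ((x : ℂ) - n - Complex.I)) := by
  suffices H : HasProd (fun j : {j : ℤ // j ≤ n} =>
      ((((j : ℤ) : ℂ) - Complex.I) / (((j : ℤ) : ℂ) + Complex.I)) *
      (((x : ℂ) - ((j : ℤ) : ℂ) - Complex.I) / ((x : ℂ) - ((j : ℤ) : ℂ) + Complex.I)))
      ((Complex.Gamma (-Complex.I - n) / Complex.Gamma (Complex.I - n)) *
        (Complex.Gamma ((x : ℂ) - n + Complex.I) / Complex.Gamma ((x : ℂ) - n - Complex.I))) from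
    ⟨H.multipliable, H.tprod_eq⟩
  rw [← (natEquivIntLE n).hasProd_iff]
  have hne : ∀ {s : ℂ}, s.im ≠ 0 → ∀ k : ℕ, s + k ≠ 0 := fun hs k hk =>
    hs (by simpa using congrArg Complex.im hk)
  convert! hasProd_add_natCast_div (a := Complex.I - n) (b := -Complex.I - n)
    (c := (x : ℂ) - n - Complex.I) (d := (x : ℂ) - n + Complex.I) (by ring)
    (hne (by simp)) (hne (by simp)) (hne (by simp)) (hne (by simp)) using 2 with k
  simp only [natEquivIntLE, Function.comp_apply, Equiv.coe_fn_mk, Int.cast_sub, Int.cast_natCast]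
  congr 1
  · rw [← neg_div_neg_eq]
    congr 1 <;> ring
  · congr 1 <;> ring
end

section
/- Define φ : ℝ → ℂ by φ(x) = Γ(x − 1 + i)/(√π · Γ(x − i)), where Γ is the complex Gamma function and i the imaginary unit. Then the integer translates of φ form an orthonormal system in L²(ℝ): for all integers n, m, ∫_ℝ φ(x − n) · conj(φ(x − m)) dx equals 1 if n = m and 0 otherwise. -/
open MeasureTheory Real

/-- A complex function holomorphic on the closed upper half-plane and `O(|z|⁻²)` there has
vanishing integral over the real line. -/
theorem integral_eq_zero_of_upper_half_plane_decay (F : ℂ → ℂ) (C : ℝ)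
    (hd : ∀ z : ℂ, 0 ≤ z.im → DifferentiableAt ℂ F z)
    (hb : ∀ z : ℂ, 0 ≤ z.im → ‖F z‖ * ‖z‖ ^ 2 ≤ C) :
    ∫ x : ℝ, F x = 0 := by
  by_cases hi : Integrable (fun x : ℝ => F x)
  swap
  · exact integral_undef hi
  have hC : ∀ (T : ℝ) (z : ℂ), 0 < T → 0 ≤ z.im → T ≤ ‖z‖ → ‖F z‖ ≤ C / T ^ 2 := by
    intro T z hT hz hTz
    rw [le_div_iff₀ (by positivity)]
    exact (mul_le_mul_of_nonneg_left (by gcongr) (norm_nonneg _)).trans (hb z hz)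
  have hlim : Filter.Tendsto (fun T : ℝ => ∫ x in (-T)..T, F x) Filter.atTop
      (nhds (∫ x : ℝ, F x)) :=
    intervalIntegral_tendsto_integral hi Filter.tendsto_neg_atTop_atBot Filter.tendsto_id
  refine tendsto_nhds_unique hlim ?_
  have h0 : Filter.Tendsto (fun T : ℝ => 4 * C * T⁻¹) Filter.atTop (nhds 0) := by
    simpa using tendsto_inv_atTop_zero.const_mul (4 * C)
  refine squeeze_zero_norm' ?_ h0
  filter_upwards [Filter.eventually_gt_atTop 0] with T hT
  have hrect := Complex.integral_boundary_rect_eq_zero_of_differentiableOn F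
    (⟨-T, 0⟩ : ℂ) (⟨T, T⟩ : ℂ) (by
      intro z hz
      have h2 : z.im ∈ Set.uIcc 0 T := hz.2
      rw [Set.uIcc_of_le hT.le] at h2
      exact (hd z h2.1).differentiableWithinAt)
  simp only [Complex.ofReal_zero, zero_mul, add_zero] at hrect
  have htop : ‖∫ x in (-T)..T, F (x + T * Complex.I)‖ ≤ C / T ^ 2 * |T - -T| := by
    refine intervalIntegral.norm_integral_le_of_norm_le_const fun x _ => hC T _ hT ?_ ?_
    · simpa using hT.le
    · simpa [abs_of_pos hT] using Complex.abs_im_le_norm ((x : ℂ) + T * Complex.I)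
  have hside : ∀ s : ℝ, |s| = T →
      ‖∫ y in (0 : ℝ)..T, F (s + y * Complex.I)‖ ≤ C / T ^ 2 * |T - 0| := by
    intro s hs
    refine intervalIntegral.norm_integral_le_of_norm_le_const fun y hy => hC T _ hT ?_ ?_
    · rw [Set.uIoc_of_le hT.le] at hy
      simpa using hy.1.le
    · simpa [hs] using Complex.abs_re_le_norm ((s : ℂ) + y * Complex.I)
  have hr := hside T (abs_of_pos hT)
  have hl := hside (-T) (by rw [abs_neg, abs_of_pos hT])
  have heq : ∫ x in (-T)..T, F x = (∫ x in (-T)..T, F (x + T * Complex.I))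
      - Complex.I * (∫ y in (0 : ℝ)..T, F (T + y * Complex.I))
      + Complex.I * (∫ y in (0 : ℝ)..T, F ((-T : ℝ) + y * Complex.I)) := by
    simp only [smul_eq_mul] at hrect
    linear_combination hrect
  rw [heq]
  refine (norm_add_le _ _).trans ((add_le_add_left (norm_sub_le _ _) _).trans ?_)
  rw [norm_mul, norm_mul, Complex.norm_I, one_mul, one_mul]
  rw [sub_zero, abs_of_pos hT] at hr hl
  rw [sub_neg_eq_add, abs_of_pos (by positivity)] at htop
  have : 4 * C * T⁻¹ = C / T ^ 2 * (T + T) + C / T ^ 2 * T + C / T ^ 2 * T := by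
    field_simp
    ring
  linarith

theorem sub_ofReal_add_I_ne_zero (z : ℂ) (hz : 0 ≤ z.im) (a : ℝ) :
    z - a + Complex.I ≠ 0 := by
  intro h
  have := congrArg Complex.im h
  simp at this
  linarith

theorem norm_sub_sub_I_le (z : ℂ) (hz : 0 ≤ z.im) (a : ℝ) :
    ‖z - a - Complex.I‖ ≤ ‖z - a + Complex.I‖ := by
  rw [← sq_le_sq₀ (norm_nonneg _) (norm_nonneg _), Complex.sq_norm, Complex.sq_norm,
    Complex.normSq_apply, Complex.normSq_apply]
  simp
  nlinarith

theorem norm_le_mul_norm_sub_add_I (z : ℂ) (hz : 0 ≤ z.im) (a : ℝ) :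
    ‖z‖ ≤ (2 + |a|) * ‖z - a + Complex.I‖ := by
  have h1 : 1 ≤ ‖z - a + Complex.I‖ := by
    have := (le_abs_self _).trans (Complex.abs_im_le_norm (z - a + Complex.I))
    simp at this
    linarith
  have h2 : ‖z‖ ≤ ‖z - a + Complex.I‖ + ‖(a : ℂ) - Complex.I‖ := by
    simpa using norm_add_le (z - a + Complex.I) ((a : ℂ) - Complex.I)
  have h3 : ‖(a : ℂ) - Complex.I‖ ≤ |a| + 1 := by
    simpa using norm_sub_le (a : ℂ) Complex.I
  nlinarith [abs_nonneg a]

/-- The integral of a Blaschke-type product with all poles in the lower half-plane vanishes. -/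
theorem integral_blaschke_prod_eq_zero (k : ℕ) (a b : ℝ) (c : ℕ → ℝ) :
    ∫ x : ℝ, ((x : ℂ) - a + Complex.I)⁻¹ * ((x : ℂ) - b + Complex.I)⁻¹ *
      ∏ j ∈ Finset.range k, (((x : ℂ) - c j - Complex.I) / ((x : ℂ) - c j + Complex.I)) = 0 := by
  refine integral_eq_zero_of_upper_half_plane_decay
    (fun z : ℂ => (z - a + Complex.I)⁻¹ * (z - b + Complex.I)⁻¹ *
      ∏ j ∈ Finset.range k, ((z - c j - Complex.I) / (z - c j + Complex.I)))
    ((2 + |a|) * (2 + |b|)) ?_ ?_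
  · intro z hz
    have h := sub_ofReal_add_I_ne_zero z hz
    refine DifferentiableAt.mul (DifferentiableAt.mul ?_ ?_) ?_
    · exact DifferentiableAt.inv (by fun_prop) (h a)
    · exact DifferentiableAt.inv (by fun_prop) (h b)
    · refine DifferentiableAt.fun_finsetProd fun j _ => ?_
      exact DifferentiableAt.div (by fun_prop) (by fun_prop) (h _)
  · intro z hz
    have h : ∀ s : ℝ, 0 < ‖z - s + Complex.I‖ :=
      fun s => norm_pos_iff.mpr (sub_ofReal_add_I_ne_zero z hz s)
    have hP : ‖∏ j ∈ Finset.range k, ((z - c j - Complex.I) / (z - c j + Complex.I))‖ ≤ 1 := by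
      rw [norm_prod]
      refine Finset.prod_le_one (fun _ _ => norm_nonneg _) fun j _ => ?_
      rw [norm_div]
      exact div_le_one_of_le₀ (norm_sub_sub_I_le z hz _) (norm_nonneg _)
    have ha := norm_le_mul_norm_sub_add_I z hz a
    have hb := norm_le_mul_norm_sub_add_I z hz b
    rw [norm_mul, norm_mul, norm_inv, norm_inv]
    calc _ ≤ ‖z - a + Complex.I‖⁻¹ * ‖z - b + Complex.I‖⁻¹ * 1 *
          (((2 + |a|) * ‖z - a + Complex.I‖) * ((2 + |b|) * ‖z - b + Complex.I‖)) := by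
          rw [sq]
          gcongr
      _ = _ := by
          have h1 := (h a).ne'
          have h2 := (h b).ne'
          field_simp

theorem Complex.Gamma_ne_zero_of_im_ne_zero {s : ℂ} (hs : s.im ≠ 0) : Complex.Gamma s ≠ 0 := by
  refine Complex.Gamma_ne_zero fun m h => hs ?_
  simp [h]

theorem ofReal_sub_add_I_ne_zero (x a : ℝ) : (x : ℂ) - a + Complex.I ≠ 0 :=
  sub_ofReal_add_I_ne_zero x (by simp) a

theorem ofReal_sub_sub_I_ne_zero (x a : ℝ) : (x : ℂ) - a - Complex.I ≠ 0 := by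
  intro h
  simpa using congrArg Complex.im h

theorem gamma_quotient_mul_conj
    (φ : ℝ → ℂ)
    (hφ : ∀ x : ℝ, φ x = Complex.Gamma ((x : ℂ) - 1 + Complex.I) /
      ((Real.sqrt π : ℂ) * Complex.Gamma ((x : ℂ) - Complex.I)))
    (x : ℝ) :
    φ x * (starRingEnd ℂ) (φ x) =
      (π : ℂ)⁻¹ * (((x : ℂ) - 1 - Complex.I) * ((x : ℂ) - 1 + Complex.I))⁻¹ := by
  have h1 : (x : ℂ) - 1 + Complex.I ≠ 0 := by exact_mod_cast ofReal_sub_add_I_ne_zero x 1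
  have h2 : (x : ℂ) - 1 - Complex.I ≠ 0 := by exact_mod_cast ofReal_sub_sub_I_ne_zero x 1
  have e1 := Complex.Gamma_add_one _ h1
  have e2 := Complex.Gamma_add_one _ h2
  have g1 : Complex.Gamma ((x : ℂ) - 1 + Complex.I) ≠ 0 :=
    Complex.Gamma_ne_zero_of_im_ne_zero (by simp)
  have g2 : Complex.Gamma ((x : ℂ) - 1 - Complex.I) ≠ 0 :=
    Complex.Gamma_ne_zero_of_im_ne_zero (by simp)
  rw [show (x : ℂ) - 1 + Complex.I + 1 = x + Complex.I by ring] at e1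
  rw [show (x : ℂ) - 1 - Complex.I + 1 = x - Complex.I by ring] at e2
  have hπ : (Real.sqrt π : ℂ) * (Real.sqrt π : ℂ) = π := by
    rw [← Complex.ofReal_mul, Real.mul_self_sqrt pi_pos.le]
  rw [hφ, map_div₀, map_mul, ← Complex.Gamma_conj, ← Complex.Gamma_conj]
  simp only [map_add, map_sub, map_one, Complex.conj_ofReal, Complex.conj_I, sub_neg_eq_add,
    ← sub_eq_add_neg]
  rw [e1, e2, ← hπ]
  have hs : (Real.sqrt π : ℂ) ≠ 0 := by
    exact_mod_cast (Real.sqrt_pos.mpr pi_pos).ne'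
  field_simp

theorem gamma_quotient_sub_one
    (φ : ℝ → ℂ)
    (hφ : ∀ x : ℝ, φ x = Complex.Gamma ((x : ℂ) - 1 + Complex.I) /
      ((Real.sqrt π : ℂ) * Complex.Gamma ((x : ℂ) - Complex.I)))
    (x : ℝ) :
    φ (x - 1) = φ x * (((x : ℂ) - 1 - Complex.I) / ((x : ℂ) - 2 + Complex.I)) := by
  have h1 : (x : ℂ) - 2 + Complex.I ≠ 0 := by exact_mod_cast ofReal_sub_add_I_ne_zero x 2
  have h2 : (x : ℂ) - 1 - Complex.I ≠ 0 := by exact_mod_cast ofReal_sub_sub_I_ne_zero x 1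
  have e1 := Complex.Gamma_add_one _ h1
  have e2 := Complex.Gamma_add_one _ h2
  have g2 : Complex.Gamma ((x : ℂ) - 1 - Complex.I) ≠ 0 :=
    Complex.Gamma_ne_zero_of_im_ne_zero (by simp)
  rw [show (x : ℂ) - 2 + Complex.I + 1 = x - 1 + Complex.I by ring] at e1
  rw [show (x : ℂ) - 1 - Complex.I + 1 = x - Complex.I by ring] at e2
  rw [hφ, hφ, e1, e2]
  push_cast
  rw [show (x : ℂ) - 1 - 1 + Complex.I = x - 2 + Complex.I by ring]
  have hs : (Real.sqrt π : ℂ) ≠ 0 := by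
    exact_mod_cast (Real.sqrt_pos.mpr pi_pos).ne'
  field_simp

theorem gamma_quotient_sub_natCast_succ
    (φ : ℝ → ℂ)
    (hφ : ∀ x : ℝ, φ x = Complex.Gamma ((x : ℂ) - 1 + Complex.I) /
      ((Real.sqrt π : ℂ) * Complex.Gamma ((x : ℂ) - Complex.I)))
    (x : ℝ) (k : ℕ) :
    φ (x - (k + 1)) = φ x * (((x : ℂ) - 1 - Complex.I) *
      ((x : ℂ) - ((k + 2 : ℝ) : ℂ) + Complex.I)⁻¹ * ∏ j ∈ Finset.range k,
        (((x : ℂ) - ((j + 2 : ℝ) : ℂ) - Complex.I) /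
          ((x : ℂ) - ((j + 2 : ℝ) : ℂ) + Complex.I))) := by
  induction k with
  | zero =>
    simp [gamma_quotient_sub_one φ hφ, div_eq_mul_inv]
  | succ k ih =>
    rw [show x - ((k + 1 : ℕ) + 1) = x - (k + 1) - 1 by push_cast; ring,
      gamma_quotient_sub_one φ hφ, ih, Finset.prod_range_succ]
    push_cast
    rw [show (x : ℂ) - (k + 1) - 1 - Complex.I = x - (k + 2) - Complex.I by ring,
      show (x : ℂ) - (k + 1) - 2 + Complex.I = x - (k + 1 + 2) + Complex.I by ring]
    ring

theorem integral_gamma_quotient_succ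
    (φ : ℝ → ℂ)
    (hφ : ∀ x : ℝ, φ x = Complex.Gamma ((x : ℂ) - 1 + Complex.I) /
      ((Real.sqrt π : ℂ) * Complex.Gamma ((x : ℂ) - Complex.I)))
    (k : ℕ) :
    ∫ x : ℝ, φ (x - (k + 1)) * (starRingEnd ℂ) (φ x) = 0 := by
  have h := integral_blaschke_prod_eq_zero k 1 (k + 2) (fun j => j + 2)
  have key : ∀ x : ℝ, φ (x - (k + 1)) * (starRingEnd ℂ) (φ x) = (π : ℂ)⁻¹ *
      (((x : ℂ) - (1 : ℝ) + Complex.I)⁻¹ * ((x : ℂ) - ((k + 2 : ℝ) : ℂ) + Complex.I)⁻¹ *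
      ∏ j ∈ Finset.range k, (((x : ℂ) - ((j + 2 : ℝ) : ℂ) - Complex.I) /
        ((x : ℂ) - ((j + 2 : ℝ) : ℂ) + Complex.I))) := by
    intro x
    have h2 : (x : ℂ) - 1 - Complex.I ≠ 0 := by exact_mod_cast ofReal_sub_sub_I_ne_zero x 1
    rw [gamma_quotient_sub_natCast_succ φ hφ, mul_right_comm, gamma_quotient_mul_conj φ hφ,
      mul_inv, Complex.ofReal_one]
    linear_combination (π : ℂ)⁻¹ * ((x : ℂ) - 1 + Complex.I)⁻¹ *
      ((x : ℂ) - ((k + 2 : ℝ) : ℂ) + Complex.I)⁻¹ *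
      (∏ j ∈ Finset.range k, (((x : ℂ) - ((j + 2 : ℝ) : ℂ) - Complex.I) /
        ((x : ℂ) - ((j + 2 : ℝ) : ℂ) + Complex.I))) * inv_mul_cancel₀ h2
  simp_rw [key]
  rw [integral_const_mul, h, mul_zero]

theorem integral_gamma_quotient_mul_conj_self
    (φ : ℝ → ℂ)
    (hφ : ∀ x : ℝ, φ x = Complex.Gamma ((x : ℂ) - 1 + Complex.I) /
      ((Real.sqrt π : ℂ) * Complex.Gamma ((x : ℂ) - Complex.I))) :
    ∫ x : ℝ, φ x * (starRingEnd ℂ) (φ x) = 1 := by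
  have key : ∀ x : ℝ, φ x * (starRingEnd ℂ) (φ x) =
      ((π⁻¹ * (1 + (x - 1) ^ 2)⁻¹ : ℝ) : ℂ) := by
    intro x
    rw [gamma_quotient_mul_conj φ hφ]
    push_cast
    congr 2
    linear_combination -Complex.I_sq
  simp_rw [key]
  rw [integral_complex_ofReal, integral_const_mul,
    integral_sub_right_eq_self (fun x : ℝ => (1 + x ^ 2)⁻¹) 1, integral_univ_inv_one_add_sq,
    inv_mul_cancel₀ pi_ne_zero, Complex.ofReal_one]

theorem integral_gamma_quotient_of_lt
    (φ : ℝ → ℂ)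
    (hφ : ∀ x : ℝ, φ x = Complex.Gamma ((x : ℂ) - 1 + Complex.I) /
      ((Real.sqrt π : ℂ) * Complex.Gamma ((x : ℂ) - Complex.I)))
    {n m : ℤ} (h : m < n) :
    ∫ x : ℝ, φ (x - n) * (starRingEnd ℂ) (φ (x - m)) = 0 := by
  obtain ⟨k, hk⟩ := Int.le.dest (Int.add_one_le_of_lt h)
  rw [← integral_gamma_quotient_succ φ hφ k,
    ← integral_sub_right_eq_self (fun x : ℝ => φ (x - (k + 1)) * (starRingEnd ℂ) (φ x)) (m : ℝ)]
  congr 1 with x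
  rw [← hk]
  push_cast
  rw [show x - ((m : ℝ) + 1 + k) = x - m - (k + 1) by ring]

/-- The integer translates of `φ(x) = Γ(x−1+i)/(√π Γ(x−i))` form an
orthonormal system in `L²(ℝ)`. -/
theorem gamma_translates_orthonormal
    (φ : ℝ → ℂ)
    (hφ : ∀ x : ℝ, φ x = Complex.Gamma ((x : ℂ) - 1 + Complex.I) /
      ((Real.sqrt π : ℂ) * Complex.Gamma ((x : ℂ) - Complex.I))) :
    ∀ n m : ℤ, ∫ x : ℝ, φ (x - n) * (starRingEnd ℂ) (φ (x - m)) =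
      if n = m then (1 : ℂ) else 0 := by
  intro n m
  rcases lt_trichotomy n m with h | rfl | h
  · rw [if_neg h.ne, ← map_zero (starRingEnd ℂ), ← integral_gamma_quotient_of_lt φ hφ h,
      ← integral_conj]
    congr 1 with x
    rw [map_mul, Complex.conj_conj, mul_comm]
  · rw [if_pos rfl, ← integral_gamma_quotient_mul_conj_self φ hφ]
    exact integral_sub_right_eq_self (fun x : ℝ => φ x * (starRingEnd ℂ) (φ x)) (n : ℝ)
  · rw [if_neg h.ne', integral_gamma_quotient_of_lt φ hφ h]
end

section
/- Let G(x) = sin(π(i − x))/sin(π(i + x)). Then: (a) for every real x, the family (G(2^j x))_{j ≤ −1} is multipliable, so that ℬ(x) = ∏_{j ≤ −1} G(2^j x) is well defined; and (b) setting ℬ_n(x) = ∏_{j ≤ n−1} G(2^j x) for n ∈ ℤ, the functions ℬ_n converge to the constant function 1 uniformly on every compact subset of ℝ as n → −∞. -/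
open Filter Topology Real

lemma Complex.sinh_le_norm_sin_add_mul_I (x y : ℝ) :
    Real.sinh y ≤ ‖Complex.sin (x + y * Complex.I)‖ := by
  have hre : (Complex.sin (x + y * Complex.I)).re = Real.sin x * Real.cosh y := by
    simp [Complex.sin_add_mul_I, Complex.sin_ofReal_re, Complex.cos_ofReal_re,
      Complex.sinh_ofReal_re, Complex.cosh_ofReal_re]
  have him : (Complex.sin (x + y * Complex.I)).im = Real.cos x * Real.sinh y := by
    simp [Complex.sin_add_mul_I, Complex.sin_ofReal_re, Complex.cos_ofReal_re,
      Complex.sinh_ofReal_re, Complex.cosh_ofReal_re]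
  refine le_of_sq_le_sq ?_ (norm_nonneg _)
  rw [Complex.sq_norm, Complex.normSq_apply, hre, him]
  nlinarith [Real.cosh_sq y, Real.sin_sq_add_cos_sq x, sq_nonneg (Real.sin x)]

lemma norm_sin_ratio_sub_one_le (x : ℝ) :
    ‖Complex.sin (π * (Complex.I - x)) / Complex.sin (π * (Complex.I + x)) - 1‖ ≤
      2 * Real.cosh π * π / Real.sinh π * |x| := by
  have hs : 0 < Real.sinh π := Real.sinh_pos_iff.2 pi_pos
  have hden : Real.sinh π ≤ ‖Complex.sin (π * (Complex.I + x))‖ := by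
    have := Complex.sinh_le_norm_sin_add_mul_I (π * x) π
    convert this using 3
    push_cast
    ring
  have hne : Complex.sin (π * (Complex.I + x)) ≠ 0 := norm_pos_iff.1 (hs.trans_le hden)
  have hnum : Complex.sin (π * (Complex.I - x)) - Complex.sin (π * (Complex.I + x)) =
      ((-(2 * Real.cosh π * Real.sin (π * x)) : ℝ) : ℂ) := by
    rw [mul_sub, mul_add, Complex.sin_sub, Complex.sin_add, Complex.cos_mul_I]
    push_cast
    ring
  rw [div_sub_one hne, norm_div, hnum, Complex.norm_real, norm_neg, Real.norm_eq_abs, abs_mul,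
    abs_of_pos (mul_pos two_pos (Real.cosh_pos π))]
  have hsin : |Real.sin (π * x)| ≤ π * |x| := by
    simpa [abs_mul, abs_of_pos pi_pos] using Real.abs_sin_le_abs (x := π * x)
  calc 2 * Real.cosh π * |Real.sin (π * x)| / ‖Complex.sin (π * (Complex.I + x))‖
      ≤ 2 * Real.cosh π * (π * |x|) / Real.sinh π := by
        have := Real.cosh_pos π
        gcongr
    _ = _ := by ring

lemma hasSum_two_zpow_subtype_le (m : ℤ) :
    HasSum (fun j : {j : ℤ // j ≤ m} => (2 : ℝ) ^ (j : ℤ)) (2 ^ (m + 1)) := by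
  let e : ℕ ≃ {j : ℤ // j ≤ m} :=
    { toFun := fun k => ⟨m - k, by lia⟩
      invFun := fun j => (m - j).toNat
      left_inv := fun k => by simp
      right_inv := fun j => by
        have := j.2
        ext
        simp only
        lia }
  rw [← e.hasSum_iff]
  convert hasSum_geometric_two' ((2 : ℝ) ^ (m + 1)) using 2 with k
  simp [e, zpow_sub₀, zpow_add₀]

/-- A product of factors that are close to `1` is close to `1`. -/
lemma multipliable_and_norm_tprod_sub_one_le {ι : Type*} {f : ι → ℂ} {u : ι → ℝ} {s : ℝ} (hu : HasSum u s)
    (hf : ∀ i, ‖f i - 1‖ ≤ u i) :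
    Multipliable f ∧ ‖∏' i, f i - 1‖ ≤ Real.exp s - 1 := by
  have hm : Multipliable f := by
    have := multipliable_one_add_of_summable (f := fun i => f i - 1)
      (Summable.of_nonneg_of_le (fun _ => norm_nonneg _) hf hu.summable)
    simpa using this
  refine ⟨hm, le_of_tendsto ((hm.hasProd.sub_const 1).norm) (Eventually.of_forall fun t => ?_)⟩
  have h := t.norm_prod_one_add_sub_one_le (fun i => f i - 1)
  simp only [add_sub_cancel] at h
  refine h.trans ?_
  gcongr
  exact (Finset.sum_le_sum fun i _ => hf i).trans
    (sum_le_hasSum t (fun i _ => (norm_nonneg _).trans (hf i)) hu)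

/-- With `G(x) = sin(π(i−x))/sin(π(i+x))`: (a) for every real `x` the
family `(G(2^j x))_{j ≤ -1}` is multipliable, so `ℬ(x) = ∏_{j ≤ -1} G(2^j x)` is well
defined; (b) the functions `ℬ_n(x) = ∏_{j ≤ n-1} G(2^j x)` converge to the constant
function `1` uniformly on every compact subset of `ℝ` as `n → -∞`. -/
theorem multiscale_blaschke_tendsto_one
    (G : ℝ → ℂ)
    (hG : ∀ x : ℝ, G x =
      Complex.sin (π * (Complex.I - x)) / Complex.sin (π * (Complex.I + x))) :
    (∀ x : ℝ, Multipliable (fun j : {j : ℤ // j ≤ -1} => G ((2 : ℝ) ^ (j : ℤ) * x))) ∧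
    (∀ K : Set ℝ, IsCompact K →
      TendstoUniformlyOn
        (fun (n : ℤ) (x : ℝ) => ∏' j : {j : ℤ // j ≤ n - 1}, G ((2 : ℝ) ^ (j : ℤ) * x))
        (fun _ => 1) atBot K) := by
  set C : ℝ := 2 * Real.cosh π * π / Real.sinh π with hC
  have hC0 : 0 ≤ C := by
    have := Real.cosh_pos π
    have := Real.sinh_pos_iff.2 pi_pos
    positivity
  have key (x R : ℝ) (hx : |x| ≤ R) (m : ℤ) :=
    multipliable_and_norm_tprod_sub_one_le (f := fun j : {j : ℤ // j ≤ m} => G ((2 : ℝ) ^ (j : ℤ) * x))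
      ((hasSum_two_zpow_subtype_le m).mul_left (C * R)) fun j => by
        rw [hG]
        refine (norm_sin_ratio_sub_one_le _).trans ?_
        rw [← hC, abs_mul, abs_of_pos (by positivity : (0 : ℝ) < 2 ^ (j : ℤ)), mul_assoc,
          mul_comm R]
        gcongr
  refine ⟨fun x => (key x _ le_rfl _).1, fun K hK => ?_⟩
  obtain ⟨R, hR⟩ := hK.isBounded.exists_norm_le
  have hlim : Tendsto (fun n : ℤ => Real.exp (C * R * 2 ^ n) - 1) atBot (𝓝 0) := by
    have h2 : Tendsto (fun n : ℤ => (2 : ℝ) ^ n) atBot (𝓝 0) := by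
      have := (tendsto_rpow_atBot_of_base_gt_one (2 : ℝ) one_lt_two).comp
        (tendsto_intCast_atBot_iff (R := ℝ) |>.2 tendsto_id)
      simpa [Function.comp_def] using this
    have h3 := (Real.continuous_exp.tendsto _).comp (h2.const_mul (C * R))
    simpa using h3.sub_const 1
  rw [Metric.tendstoUniformlyOn_iff]
  intro ε hε
  filter_upwards [hlim.eventually (gt_mem_nhds hε)] with n hn x hx
  have h := (key x R (hR x hx) (n - 1)).2
  rw [sub_add_cancel] at h
  rw [dist_comm, dist_eq_norm]
  exact h.trans_lt hn
end

section
/- Let G(x) = sin(π(i − x))/sin(π(i + x)), let ℬ(x) = ∏_{j ≤ −1} G(2^j x), and let φ(x) = Γ(x − 1 + i)/(√π · Γ(x − i)). For integers n, j define φ_{n,j}(x) = 2^{n/2} · φ(2^n x − j) · ℬ(2^n x). Then the family (φ_{n,j})_{(n,j) ∈ ℤ×ℤ} is orthonormal in L²(ℝ): for all (n,j) and (m,k), ∫_ℝ φ_{n,j}(x) · conj(φ_{m,k}(x)) dx equals 1 if (n,j) = (m,k) and 0 otherwise. -/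
open MeasureTheory Real

theorem one_add_norm_le_mul_norm_sub {a z : ℂ} (ha : 0 < a.im) (hz : z.im ≤ 0) :
    1 + ‖z‖ ≤ (1 + (1 + ‖a‖) / a.im) * ‖z - a‖ := by
  have him : a.im ≤ ‖z - a‖ := by
    have h := Complex.abs_im_le_norm (z - a)
    rw [Complex.sub_im, abs_of_nonpos (by linarith)] at h
    linarith
  have htri : ‖z‖ ≤ ‖z - a‖ + ‖a‖ := by simpa using norm_add_le (z - a) a
  have hmul : 1 + ‖a‖ ≤ (1 + ‖a‖) / a.im * ‖z - a‖ := by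
    rw [div_mul_eq_mul_div, le_div_iff₀ ha]
    gcongr
  linarith

/-- A function holomorphic on the closed lower half-plane and decaying quadratically there has
vanishing integral over the real line. -/
theorem integral_eq_zero_of_quadratic_decay {f : ℂ → ℂ} {C : ℝ}
    (hf : ∀ z : ℂ, z.im ≤ 0 → DifferentiableAt ℂ f z)
    (hC : ∀ z : ℂ, z.im ≤ 0 → ‖f z‖ ≤ C / (1 + ‖z‖) ^ 2) :
    ∫ x : ℝ, f x = 0 := by
  have hC0 : 0 ≤ C := by simpa using (norm_nonneg _).trans (hC 0 le_rfl)
  have hcont : Continuous fun x : ℝ => f x := continuous_iff_continuousAt.2 fun x =>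
    ContinuousAt.comp (f := fun x : ℝ => (x : ℂ)) (hf x (by simp)).continuousAt
      Complex.continuous_ofReal.continuousAt
  have hint : Integrable fun x : ℝ => f x := by
    refine (integrable_inv_one_add_sq.const_mul C).mono' hcont.aestronglyMeasurable
      (Filter.Eventually.of_forall fun x => (hC x (by simp)).trans ?_)
    rw [div_eq_mul_inv, Complex.norm_real, Real.norm_eq_abs]
    gcongr
    nlinarith [sq_abs x, abs_nonneg x]
  have hlim := intervalIntegral_tendsto_integral hint
    Filter.tendsto_neg_atTop_atBot Filter.tendsto_id
  refine tendsto_nhds_unique hlim (squeeze_zero_norm' (a := fun R : ℝ => 4 * C * R⁻¹) ?_ ?_)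
  · filter_upwards [Filter.eventually_gt_atTop 0] with R hR
    have hside : ∀ z : ℂ, z.im ≤ 0 → R ≤ ‖z‖ → ‖f z‖ ≤ C / R ^ 2 := fun z hz hRz =>
      (hC z hz).trans (by gcongr; linarith)
    have hrect := Complex.integral_boundary_rect_eq_zero_of_differentiableOn f
      (⟨-R, -R⟩ : ℂ) (⟨R, 0⟩ : ℂ) fun z hz => by
        have him : z.im ∈ Set.uIcc (-R) 0 := hz.2
        rw [Set.uIcc_of_le (by linarith)] at him
        exact (hf z him.2).differentiableWithinAt
    simp only [Complex.ofReal_zero, zero_mul, add_zero] at hrect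
    have hbot : ‖∫ x : ℝ in -R..R, f (x + (-R : ℝ) * Complex.I)‖ ≤ C / R ^ 2 * |R - -R| := by
      refine intervalIntegral.norm_integral_le_of_norm_le_const fun x _ => hside _ ?_ ?_
      · simp [hR.le]
      · refine le_trans ?_ (Complex.abs_im_le_norm _)
        simp [abs_of_pos hR]
    have hvert : ∀ r : ℝ, |r| = R →
        ‖∫ y : ℝ in -R..0, f (r + y * Complex.I)‖ ≤ C / R ^ 2 * |0 - -R| := by
      intro r hr
      refine intervalIntegral.norm_integral_le_of_norm_le_const fun y hy => hside _ ?_ ?_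
      · rw [Set.uIoc_of_le (by linarith)] at hy
        simpa using hy.2
      · refine le_trans ?_ (Complex.abs_re_le_norm _)
        simp [hr]
    have hR1 := hvert R (abs_of_pos hR)
    have hR2 := hvert (-R) (by rw [abs_neg, abs_of_pos hR])
    have heq : ∫ x : ℝ in -R..R, f x = (∫ x : ℝ in -R..R, f (x + (-R : ℝ) * Complex.I)) +
        Complex.I • (∫ y : ℝ in -R..0, f (R + y * Complex.I)) -
        Complex.I • (∫ y : ℝ in -R..0, f ((-R : ℝ) + y * Complex.I)) := by
      linear_combination -hrect
    have hsum : C / R ^ 2 * |R - -R| + C / R ^ 2 * |0 - -R| + C / R ^ 2 * |0 - -R| =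
        4 * C * R⁻¹ := by
      rw [abs_of_pos (by linarith), abs_of_pos (by linarith)]
      field_simp
      ring
    rw [id, heq, ← hsum]
    refine (norm_sub_le _ _).trans (add_le_add ((norm_add_le _ _).trans (add_le_add hbot ?_)) ?_)
    · simpa [norm_smul] using hR1
    · simpa [norm_smul] using hR2
  · simpa using tendsto_inv_atTop_zero.const_mul (4 * C)

/-- If `g` is holomorphic and bounded on the closed lower half-plane, then its product with two
simple poles in the upper half-plane integrates to zero over the real line. -/
theorem integral_mul_inv_sub_mul_inv_sub_eq_zero {g : ℂ → ℂ} {a b : ℂ} {C : ℝ}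
    (ha : 0 < a.im) (hb : 0 < b.im)
    (hg : ∀ z : ℂ, z.im ≤ 0 → DifferentiableAt ℂ g z) (hC : ∀ z : ℂ, z.im ≤ 0 → ‖g z‖ ≤ C) :
    ∫ x : ℝ, g x * ((x - a)⁻¹ * (x - b)⁻¹) = 0 := by
  have hne : ∀ {c z : ℂ}, 0 < c.im → z.im ≤ 0 → z - c ≠ 0 := fun {c z} hc hz h => by
    rw [sub_eq_zero.1 h] at hz
    linarith
  refine integral_eq_zero_of_quadratic_decay (f := fun z => g z * ((z - a)⁻¹ * (z - b)⁻¹))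
    (C := C * ((1 + (1 + ‖a‖) / a.im) * (1 + (1 + ‖b‖) / b.im))) (fun z hz => ?_) fun z hz => ?_
  · exact (hg z hz).mul (((differentiableAt_id.sub_const a).inv (hne ha hz)).mul
      ((differentiableAt_id.sub_const b).inv (hne hb hz)))
  · have hinv : ∀ {c : ℂ}, 0 < c.im → ‖(z - c)⁻¹‖ ≤ (1 + (1 + ‖c‖) / c.im) / (1 + ‖z‖) := by
      intro c hc
      rw [norm_inv, inv_eq_one_div, div_le_div_iff₀ (norm_pos_iff.2 (hne hc hz)) (by positivity),
        one_mul]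
      exact one_add_norm_le_mul_norm_sub hc hz
    calc ‖g z * ((z - a)⁻¹ * (z - b)⁻¹)‖
        ≤ C * ((1 + (1 + ‖a‖) / a.im) / (1 + ‖z‖) * ((1 + (1 + ‖b‖) / b.im) / (1 + ‖z‖))) := by
          rw [norm_mul, norm_mul]
          have hC0 : 0 ≤ C := (norm_nonneg _).trans (hC z hz)
          exact mul_le_mul (hC z hz) (mul_le_mul (hinv ha) (hinv hb) (norm_nonneg _)
            ((norm_nonneg _).trans (hinv ha))) (by positivity) hC0
      _ = _ := by
          have : 1 + ‖z‖ ≠ 0 := by positivity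
          field_simp

/-- On a vertical line, `‖Γ‖` is a decreasing function of the distance to the real axis. -/
theorem norm_Gamma_div_Gamma_le_one {a b : ℂ} (hre : a.re = b.re) (him : |b.im| ≤ |a.im|) :
    ‖Complex.Gamma a / Complex.Gamma b‖ ≤ 1 := by
  by_cases hb : Complex.Gamma b = 0
  · simp [hb]
  have hbn : ∀ j : ℕ, b + j ≠ 0 := fun j h =>
    hb ((Complex.Gamma_eq_zero_iff b).2 ⟨j, eq_neg_of_add_eq_zero_left h⟩)
  rw [norm_div, div_le_one (norm_pos_iff.2 hb)]
  refine le_of_tendsto_of_tendsto (Complex.GammaSeq_tendsto_Gamma a).norm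
    (Complex.GammaSeq_tendsto_Gamma b).norm ?_
  filter_upwards [Filter.eventually_gt_atTop 0] with n hn
  simp only [Complex.GammaSeq, norm_div, norm_mul, Complex.norm_natCast_cpow_of_pos hn, norm_prod,
    hre]
  refine div_le_div_of_nonneg_left (by positivity)
    (Finset.prod_pos fun j _ => norm_pos_iff.2 (hbn j))
    (Finset.prod_le_prod (fun j _ => norm_nonneg _) fun j _ => ?_)
  rw [← sq_le_sq₀ (norm_nonneg _) (norm_nonneg _), ← Complex.normSq_eq_norm_sq,
    ← Complex.normSq_eq_norm_sq]
  simp only [Complex.normSq_apply, Complex.add_re, Complex.add_im, Complex.natCast_re,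
    Complex.natCast_im, add_zero, hre]
  nlinarith [sq_le_sq.2 him]

theorem differentiableAt_Gamma_of_im_ne_zero {z : ℂ} (hz : z.im ≠ 0) :
    DifferentiableAt ℂ Complex.Gamma z :=
  Complex.differentiableAt_Gamma z fun m h => hz (by simp [h])

theorem Gamma_add_natCast_eq_mul_prod {w : ℂ} (hw : w.im ≠ 0) (n : ℕ) :
    Complex.Gamma (w + n) = Complex.Gamma w * ∏ l ∈ Finset.range n, (w + l) := by
  induction n with
  | zero => simp
  | succ n ih =>
    have hne : w + n ≠ 0 := fun h => hw (by simpa using congrArg Complex.im h)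
    rw [Finset.prod_range_succ, Nat.cast_succ, ← add_assoc, Complex.Gamma_add_one _ hne, ih]
    ring

theorem Gamma_ne_zero_of_im_ne_zero {w : ℂ} (hw : w.im ≠ 0) : Complex.Gamma w ≠ 0 :=
  Complex.Gamma_ne_zero fun m h => hw (by simp [h])

theorem sin_pi_mul_ne_zero_of_im_ne_zero {w : ℂ} (hw : w.im ≠ 0) :
    Complex.sin (π * w) ≠ 0 := by
  rw [Complex.sin_ne_zero_iff]
  intro k h
  have hπ : (π : ℂ) ≠ 0 := by exact_mod_cast Real.pi_ne_zero
  have hwk : w = k := mul_left_cancel₀ hπ (by rw [h]; ring)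
  exact hw (by simp [hwk])

theorem normSq_sin_eq (z : ℂ) :
    Complex.normSq (Complex.sin z) = Real.sin z.re ^ 2 + Real.sinh z.im ^ 2 := by
  rw [Complex.sin_eq, ← Complex.ofReal_sin, ← Complex.ofReal_cos, ← Complex.ofReal_sinh,
    ← Complex.ofReal_cosh, ← Complex.ofReal_mul, ← Complex.ofReal_mul, Complex.normSq_add_mul_I]
  nlinarith [Real.sin_sq_add_cos_sq z.re, Real.cosh_sq z.im]

theorem norm_sin_div_sin_le_one {a b : ℂ} (hre : |a.re| = |b.re|) (him : |a.im| ≤ |b.im|) :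
    ‖Complex.sin a / Complex.sin b‖ ≤ 1 := by
  rw [norm_div]
  refine div_le_one_of_le₀ ?_ (norm_nonneg _)
  rw [← sq_le_sq₀ (norm_nonneg _) (norm_nonneg _), ← Complex.normSq_eq_norm_sq,
    ← Complex.normSq_eq_norm_sq, normSq_sin_eq, normSq_sin_eq]
  have hsin : Real.sin a.re ^ 2 = Real.sin b.re ^ 2 := by
    rw [Real.sin_sq, Real.sin_sq, ← Real.cos_abs, hre, Real.cos_abs]
  have hsinh : Real.sinh a.im ^ 2 ≤ Real.sinh b.im ^ 2 := by
    rw [sq_le_sq, Real.abs_sinh, Real.abs_sinh]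
    exact Real.sinh_le_sinh.2 him
  linarith

/-- The quotient of sines `sin(π(i − x))/sin(π(i + x))`. -/
noncomputable def sineQuotient (x : ℝ) : ℂ :=
  Complex.sin (π * (Complex.I - x)) / Complex.sin (π * (Complex.I + x))

theorem sin_pi_mul_I_add_ne_zero (x : ℝ) : Complex.sin (π * (Complex.I + x)) ≠ 0 :=
  sin_pi_mul_ne_zero_of_im_ne_zero (by simp)

theorem conj_sineQuotient (x : ℝ) :
    (starRingEnd ℂ) (sineQuotient x) =
      Complex.sin (π * (Complex.I + x)) / Complex.sin (π * (Complex.I - x)) := by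
  rw [sineQuotient, map_div₀, ← Complex.sin_conj, ← Complex.sin_conj, ← neg_div_neg_eq,
    ← Complex.sin_neg, ← Complex.sin_neg]
  simp only [map_mul, map_sub, map_add, Complex.conj_ofReal, Complex.conj_I]
  congr 2 <;> ring

theorem norm_sineQuotient (x : ℝ) : ‖sineQuotient x‖ = 1 := by
  have h : sineQuotient x * (starRingEnd ℂ) (sineQuotient x) = 1 := by
    rw [conj_sineQuotient, sineQuotient, div_mul_div_comm, mul_comm, div_self]
    refine mul_ne_zero (sin_pi_mul_I_add_ne_zero x) (sin_pi_mul_ne_zero_of_im_ne_zero ?_)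
    simp
  have h' := congrArg norm h
  rw [norm_mul, RCLike.norm_conj, norm_one] at h'
  nlinarith [norm_nonneg (sineQuotient x)]

theorem sineQuotient_sub_intCast (x : ℝ) (j : ℤ) : sineQuotient (x - j) = sineQuotient x := by
  have hnum : (π : ℂ) * (Complex.I - ((x - j : ℝ) : ℂ)) = π * (Complex.I - x) + j * π := by
    push_cast; ring
  have hden : (π : ℂ) * (Complex.I + ((x - j : ℝ) : ℂ)) = π * (Complex.I + x) - j * π := by
    push_cast; ring
  rw [sineQuotient, sineQuotient, hnum, hden, Complex.sin_antiperiodic.add_int_mul_eq,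
    Complex.sin_antiperiodic.sub_int_mul_eq, mul_div_mul_left]
  simp

theorem isBigO_sineQuotient_sub_one :
    (fun x : ℝ => sineQuotient x - 1) =O[nhds 0] fun x : ℝ => x := by
  have hdiff : DifferentiableAt ℝ sineQuotient 0 := by
    have hofReal : DifferentiableAt ℝ (fun x : ℝ => (x : ℂ)) 0 :=
      Complex.ofRealCLM.differentiableAt
    have hsin : ∀ {u : ℝ → ℂ}, DifferentiableAt ℝ u 0 →
        DifferentiableAt ℝ (fun x => Complex.sin (u x)) 0 := fun hu =>
      (Complex.differentiable_sin.restrictScalars ℝ).differentiableAt.comp (0 : ℝ) hu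
    unfold sineQuotient
    exact (hsin ((hofReal.const_sub _).const_mul _)).div
      (hsin ((hofReal.const_add _).const_mul _)) (sin_pi_mul_I_add_ne_zero 0)
  have hzero : sineQuotient 0 = 1 := by
    have h := sin_pi_mul_I_add_ne_zero 0
    rw [Complex.ofReal_zero, add_zero] at h
    simp [sineQuotient, div_self h]
  simpa [hzero] using hdiff.isBigO_sub

theorem multipliable_sineQuotient_div_two_pow (x : ℝ) :
    Multipliable fun k : ℕ => sineQuotient (x / 2 ^ (k + 1)) := by
  have hgeom : Summable fun k : ℕ => x / 2 ^ (k + 1) := by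
    refine (summable_geometric_two.mul_left (x / 2)).congr fun k => ?_
    rw [pow_succ, one_div, inv_pow]
    field_simp
  have hsum := summable_of_isBigO_nat hgeom
    (isBigO_sineQuotient_sub_one.comp_tendsto hgeom.tendsto_atTop_zero)
  simpa [Function.comp_def] using multipliable_one_add_of_summable hsum.norm

/-- The product `∏_{j ≤ −1} G(2^j x)` of dilated sine quotients. -/
noncomputable def sineProduct (x : ℝ) : ℂ :=
  ∏' j : {j : ℤ // j ≤ -1}, sineQuotient ((2 : ℝ) ^ (j : ℤ) * x)

theorem sineProduct_eq_tprod_nat (x : ℝ) :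
    sineProduct x = ∏' k : ℕ, sineQuotient (x / 2 ^ (k + 1)) := by
  let e : ℕ ≃ {j : ℤ // j ≤ -1} :=
    { toFun := fun k => ⟨-(k + 1 : ℤ), by lia⟩
      invFun := fun j => (-(j : ℤ) - 1).toNat
      left_inv := fun k => by simp
      right_inv := fun ⟨j, hj⟩ => by
        simp only [Subtype.mk.injEq]
        lia }
  rw [sineProduct, ← e.tprod_eq]
  refine tprod_congr fun k => congrArg sineQuotient ?_
  change (2 : ℝ) ^ (-((k : ℤ) + 1)) * x = _
  rw [zpow_neg, div_eq_inv_mul]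
  norm_cast

theorem norm_sineProduct (x : ℝ) : ‖sineProduct x‖ = 1 := by
  rw [sineProduct_eq_tprod_nat, (multipliable_sineQuotient_div_two_pow x).norm_tprod]
  simp [norm_sineQuotient]

theorem sineProduct_two_mul (x : ℝ) :
    sineProduct (2 * x) = sineQuotient x * sineProduct x := by
  have hshift : ∀ k : ℕ, 2 * x / 2 ^ (k + 1) = x / 2 ^ k := fun k => by
    rw [pow_succ']
    exact mul_div_mul_left x _ two_ne_zero
  simp only [sineProduct_eq_tprod_nat, hshift]
  rw [tprod_eq_zero_mul' (f := fun k : ℕ => sineQuotient (x / 2 ^ k))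
    (multipliable_sineQuotient_div_two_pow x), pow_zero, div_one]

theorem sineProduct_two_pow_mul (p : ℕ) (x : ℝ) :
    sineProduct (2 ^ p * x) =
      (∏ l ∈ Finset.range p, sineQuotient (2 ^ l * x)) * sineProduct x := by
  induction p with
  | zero => simp
  | succ p ih =>
    rw [pow_succ', mul_assoc, sineProduct_two_mul, ih, Finset.prod_range_succ]
    ring

theorem sineProduct_mul_conj_two_pow_mul (p : ℕ) (x : ℝ) :
    sineProduct x * (starRingEnd ℂ) (sineProduct (2 ^ p * x)) =
      ∏ l ∈ Finset.range p, (starRingEnd ℂ) (sineQuotient (2 ^ l * x)) := by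
  rw [sineProduct_two_pow_mul, map_mul, map_prod, mul_left_comm, RCLike.mul_conj,
    norm_sineProduct]
  simp

/-- The function `Γ(x − 1 + i)/(√π Γ(x − i))` generating the wavelet system. -/
noncomputable def gammaWavelet (x : ℝ) : ℂ :=
  Complex.Gamma ((x : ℂ) - 1 + Complex.I) /
    ((Real.sqrt π : ℂ) * Complex.Gamma ((x : ℂ) - Complex.I))

theorem gammaWavelet_eq_div_mul_inv (x : ℝ) :
    gammaWavelet x = (Real.sqrt π : ℂ)⁻¹ *
      (Complex.Gamma (x + Complex.I) / Complex.Gamma (x - Complex.I)) *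
        (x - (1 - Complex.I))⁻¹ := by
  have hne : (x : ℂ) - 1 + Complex.I ≠ 0 := fun h => by simpa using congrArg Complex.im h
  have hrec := Complex.Gamma_add_one _ hne
  rw [show (x : ℂ) - 1 + Complex.I + 1 = x + Complex.I by ring] at hrec
  rw [gammaWavelet, hrec, show (x : ℂ) - (1 - Complex.I) = x - 1 + Complex.I by ring]
  field_simp

theorem conj_gammaWavelet (x : ℝ) :
    (starRingEnd ℂ) (gammaWavelet x) = (Real.sqrt π : ℂ)⁻¹ *
      (Complex.Gamma (x - Complex.I) / Complex.Gamma (x + Complex.I)) *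
        (x - (1 + Complex.I))⁻¹ := by
  simp only [gammaWavelet_eq_div_mul_inv, map_mul, map_inv₀, map_div₀, ← Complex.Gamma_conj,
    map_add, map_sub, Complex.conj_ofReal, Complex.conj_I, map_one, sub_neg_eq_add]
  rfl

theorem gammaWavelet_mul_conj_sineQuotient (x : ℝ) :
    gammaWavelet x * (starRingEnd ℂ) (sineQuotient x) = -(Real.sqrt π : ℂ)⁻¹ *
      (Complex.Gamma (2 - x + Complex.I) / Complex.Gamma (2 - x - Complex.I)) *
        (x - (1 + Complex.I))⁻¹ := by
  have hI : (x : ℂ) - (1 + Complex.I) ≠ 0 := fun h => by simpa using congrArg Complex.im h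
  have hrefl₁ := Complex.Gamma_mul_Gamma_one_sub ((x : ℂ) - 1 + Complex.I)
  have hrefl₂ := Complex.Gamma_mul_Gamma_one_sub ((x : ℂ) - Complex.I)
  have hrec := Complex.Gamma_add_one (1 - ((x : ℂ) - Complex.I)) (fun h => hI (by
    linear_combination -h))
  rw [show (1 : ℂ) - (x - Complex.I) + 1 = 2 - x + Complex.I by ring] at hrec
  rw [show (1 : ℂ) - (x - 1 + Complex.I) = 2 - x - Complex.I by ring,
    show (π : ℂ) * (x - 1 + Complex.I) = π * (Complex.I + x) - π by ring,
    Complex.sin_sub_pi] at hrefl₁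
  rw [show (π : ℂ) * (x - Complex.I) = -(π * (Complex.I - x)) by ring,
    Complex.sin_neg] at hrefl₂
  have hs₁ := sin_pi_mul_I_add_ne_zero x
  have hs₂ : Complex.sin (π * (Complex.I - x)) ≠ 0 := sin_pi_mul_ne_zero_of_im_ne_zero (by simp)
  have hΓ₁ : Complex.Gamma (x - Complex.I) ≠ 0 := Gamma_ne_zero_of_im_ne_zero (by simp)
  have hΓ₂ : Complex.Gamma (2 - x - Complex.I) ≠ 0 := Gamma_ne_zero_of_im_ne_zero (by simp)
  have hπ : (Real.sqrt π : ℂ) ≠ 0 := by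
    exact_mod_cast (Real.sqrt_pos.2 Real.pi_pos).ne'
  have h₁ : Complex.Gamma ((x : ℂ) - 1 + Complex.I) * Complex.sin (π * (Complex.I + x)) =
      -π / Complex.Gamma (2 - x - Complex.I) := by
    rw [eq_div_iff hΓ₂, mul_right_comm, hrefl₁]
    field_simp
  have h₂ : Complex.Gamma ((x : ℂ) - Complex.I) * Complex.sin (π * (Complex.I - x)) *
      Complex.Gamma (2 - x + Complex.I) = π * (x - (1 + Complex.I)) := by
    rw [hrec]
    linear_combination (1 - ((x : ℂ) - Complex.I)) * Complex.sin (π * (Complex.I - x)) *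
      hrefl₂ + (1 - ((x : ℂ) - Complex.I)) * π * (- mul_inv_cancel₀ hs₂)
  rw [gammaWavelet, conj_sineQuotient, div_mul_div_comm, h₁, div_eq_iff (by positivity)]
  field_simp
  linear_combination h₂

theorem integral_gammaWavelet_add_mul_conj_eq_zero (n : ℕ) :
    ∫ x : ℝ, gammaWavelet (x + (n + 1)) * (starRingEnd ℂ) (gammaWavelet x) = 0 := by
  have hπ : (Real.sqrt π : ℂ) ≠ 0 := by
    exact_mod_cast (Real.sqrt_pos.2 Real.pi_pos).ne'
  have hne : ∀ {z : ℂ}, z.im ≤ 0 → ∀ l : ℕ, z - Complex.I + l ≠ 0 := fun {z} hz l h => by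
    have := congrArg Complex.im h
    simp at this
    linarith
  have hpoint : ∀ x : ℝ, gammaWavelet (x + (n + 1)) * (starRingEnd ℂ) (gammaWavelet x) =
      ((Real.sqrt π : ℂ)⁻¹ ^ 2 *
        ∏ l ∈ Finset.range n, (((x : ℂ) + Complex.I + l) / (x - Complex.I + l))) *
          ((x - (1 + Complex.I))⁻¹ * (x - (Complex.I - n))⁻¹) := by
    intro x
    have hx : ∀ l : ℕ, (x : ℂ) - Complex.I + l ≠ 0 := hne (by simp)
    have hP : ∏ l ∈ Finset.range n, ((x : ℂ) - Complex.I + l) ≠ 0 :=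
      Finset.prod_ne_zero_iff.2 fun l _ => hx l
    have hnum := Gamma_add_natCast_eq_mul_prod (w := x + Complex.I) (by simp) n
    have hden := Gamma_add_natCast_eq_mul_prod (w := x - Complex.I) (by simp) n
    have hrec := Complex.Gamma_add_one _ (hx n)
    have hΓ₁ : Complex.Gamma (x - Complex.I) ≠ 0 := Gamma_ne_zero_of_im_ne_zero (by simp)
    have hΓ₂ : Complex.Gamma (x + Complex.I) ≠ 0 := Gamma_ne_zero_of_im_ne_zero (by simp)
    have hxn := hx n
    have hxI : (x : ℂ) - (1 + Complex.I) ≠ 0 := fun h => by simpa using congrArg Complex.im h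
    rw [conj_gammaWavelet, gammaWavelet, Finset.prod_div_distrib,
      show ((x + (n + 1) : ℝ) : ℂ) - 1 + Complex.I = x + Complex.I + n by push_cast; ring,
      show ((x + (n + 1) : ℝ) : ℂ) - Complex.I = x - Complex.I + n + 1 by push_cast; ring,
      show (x : ℂ) - (Complex.I - n) = x - Complex.I + n by ring, hrec, hnum, hden]
    field_simp
  simp only [hpoint]
  refine integral_mul_inv_sub_mul_inv_sub_eq_zero (g := fun z => (Real.sqrt π : ℂ)⁻¹ ^ 2 *
    ∏ l ∈ Finset.range n, ((z + Complex.I + l) / (z - Complex.I + l)))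
    (C := ‖(Real.sqrt π : ℂ)⁻¹ ^ 2‖) (by simp) (by simp) (fun z hz => ?_) fun z hz => ?_
  · refine (DifferentiableAt.fun_finsetProd fun l _ => ?_).const_mul _
    exact DifferentiableAt.div (by fun_prop) (by fun_prop) (hne hz l)
  · rw [norm_mul, norm_prod]
    refine mul_le_of_le_one_right (norm_nonneg _)
      (Finset.prod_le_one (fun _ _ => norm_nonneg _) fun l _ => ?_)
    rw [norm_div, div_le_one (norm_pos_iff.2 (hne hz l)), ← sq_le_sq₀ (norm_nonneg _)
      (norm_nonneg _), ← Complex.normSq_eq_norm_sq, ← Complex.normSq_eq_norm_sq]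
    simp [Complex.normSq_apply]
    nlinarith

theorem integral_gammaWavelet_mul_conj_self :
    ∫ x : ℝ, gammaWavelet x * (starRingEnd ℂ) (gammaWavelet x) = 1 := by
  have hpoint : ∀ x : ℝ, gammaWavelet x * (starRingEnd ℂ) (gammaWavelet x) =
      ((π⁻¹ * (1 + (x - 1) ^ 2)⁻¹ : ℝ) : ℂ) := by
    intro x
    have hΓ₁ : Complex.Gamma (x - Complex.I) ≠ 0 := Gamma_ne_zero_of_im_ne_zero (by simp)
    have hΓ₂ : Complex.Gamma (x + Complex.I) ≠ 0 := Gamma_ne_zero_of_im_ne_zero (by simp)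
    have hsq : (Real.sqrt π : ℂ) * Real.sqrt π = π := by
      exact_mod_cast Real.mul_self_sqrt Real.pi_pos.le
    have hprod : ((x : ℂ) - (1 - Complex.I)) * (x - (1 + Complex.I)) = 1 + (x - 1) ^ 2 := by
      linear_combination -Complex.I_sq
    have hcancel : Complex.Gamma (x + Complex.I) / Complex.Gamma (x - Complex.I) *
        (Complex.Gamma (x - Complex.I) / Complex.Gamma (x + Complex.I)) = 1 := by
      field_simp
    rw [conj_gammaWavelet, gammaWavelet_eq_div_mul_inv]
    push_cast
    rw [← hprod, ← hsq, mul_inv, mul_inv]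
    linear_combination (Real.sqrt π : ℂ)⁻¹ * (Real.sqrt π : ℂ)⁻¹ *
      ((x : ℂ) - (1 - Complex.I))⁻¹ * ((x : ℂ) - (1 + Complex.I))⁻¹ * hcancel
  simp only [hpoint]
  rw [integral_complex_ofReal, integral_const_mul,
    integral_sub_right_eq_self (fun x : ℝ => (1 + x ^ 2)⁻¹) 1, integral_univ_inv_one_add_sq,
    inv_mul_cancel₀ Real.pi_ne_zero, Complex.ofReal_one]

theorem integral_gammaWavelet_sub_mul_conj_of_lt {j k : ℤ} (hjk : j < k) :
    ∫ x : ℝ, gammaWavelet (x - j) * (starRingEnd ℂ) (gammaWavelet (x - k)) = 0 := by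
  obtain ⟨n, hn⟩ := Int.le.dest (Int.add_one_le_of_lt hjk)
  rw [← integral_gammaWavelet_add_mul_conj_eq_zero n, ← integral_sub_right_eq_self
    (fun x => gammaWavelet (x + (n + 1)) * (starRingEnd ℂ) (gammaWavelet x)) (k : ℝ)]
  congr 1 with x
  congr 2
  rw [← hn]
  push_cast
  ring

theorem integral_mul_conj_swap (f g : ℝ → ℂ) :
    ∫ x : ℝ, f x * (starRingEnd ℂ) (g x) =
      (starRingEnd ℂ) (∫ x : ℝ, g x * (starRingEnd ℂ) (f x)) := by
  rw [← integral_conj]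
  simp [mul_comm]

theorem integral_gammaWavelet_sub_mul_conj (j k : ℤ) :
    ∫ x : ℝ, gammaWavelet (x - j) * (starRingEnd ℂ) (gammaWavelet (x - k)) =
      if j = k then 1 else 0 := by
  rcases lt_trichotomy j k with h | rfl | h
  · rw [integral_gammaWavelet_sub_mul_conj_of_lt h, if_neg h.ne]
  · rw [if_pos rfl, integral_sub_right_eq_self
      (fun x => gammaWavelet x * (starRingEnd ℂ) (gammaWavelet x)) (j : ℝ),
      integral_gammaWavelet_mul_conj_self]
  · rw [integral_mul_conj_swap, integral_gammaWavelet_sub_mul_conj_of_lt h, if_neg h.ne', map_zero]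

theorem integral_gammaWavelet_mul_sineProduct_mul_conj_two_pow_eq_zero (p : ℕ) (j k : ℤ) :
    ∫ x : ℝ, gammaWavelet (x - j) * sineProduct x * (starRingEnd ℂ)
      (gammaWavelet (2 ^ (p + 1) * x - k) * sineProduct (2 ^ (p + 1) * x)) = 0 := by
  have htwo : (2 : ℂ) ^ (p + 1) ≠ 0 := pow_ne_zero _ two_ne_zero
  set c : ℂ := -(Real.sqrt π : ℂ)⁻¹ ^ 2 * (2 ^ (p + 1))⁻¹ with hc
  set g : ℂ → ℂ := fun z => c *
    (Complex.Gamma (2 - (z - j) + Complex.I) / Complex.Gamma (2 - (z - j) - Complex.I) *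
      (Complex.Gamma (2 ^ (p + 1) * z - k - Complex.I) /
        Complex.Gamma (2 ^ (p + 1) * z - k + Complex.I)) *
      ∏ l ∈ Finset.range p, (Complex.sin (π * (Complex.I + 2 ^ (l + 1) * z)) /
        Complex.sin (π * (Complex.I - 2 ^ (l + 1) * z)))) with hg
  have hpoint : ∀ x : ℝ, gammaWavelet (x - j) * sineProduct x * (starRingEnd ℂ)
      (gammaWavelet (2 ^ (p + 1) * x - k) * sineProduct (2 ^ (p + 1) * x)) =
      g x * ((x - (j + 1 + Complex.I))⁻¹ * (x - (k + 1 + Complex.I) / 2 ^ (p + 1))⁻¹) := by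
    intro x
    have hfactor : ((2 : ℂ) ^ (p + 1) * x - k - (1 + Complex.I))⁻¹ =
        (2 ^ (p + 1))⁻¹ * (x - (k + 1 + Complex.I) / 2 ^ (p + 1))⁻¹ := by
      rw [← mul_inv, mul_sub, mul_div_cancel₀ _ htwo]
      ring
    have hprod : ∀ l : ℕ, (starRingEnd ℂ) (sineQuotient (2 ^ (l + 1) * x)) =
        Complex.sin (π * (Complex.I + 2 ^ (l + 1) * x)) /
          Complex.sin (π * (Complex.I - 2 ^ (l + 1) * x)) := fun l => by
      rw [conj_sineQuotient]
      push_cast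
      rfl
    have hconj := conj_gammaWavelet (2 ^ (p + 1) * x - k)
    have hzero := gammaWavelet_mul_conj_sineQuotient (x - j)
    rw [sineQuotient_sub_intCast] at hzero
    push_cast at hconj hzero
    rw [hfactor] at hconj
    rw [map_mul, mul_mul_mul_comm, sineProduct_mul_conj_two_pow_mul, Finset.prod_range_succ',
      pow_zero, one_mul, Finset.prod_congr rfl fun l _ => hprod l, hconj, hg, hc]
    rw [show (x : ℂ) - (j + 1 + Complex.I) = x - j - (1 + Complex.I) by ring]
    linear_combination (Real.sqrt π : ℂ)⁻¹ *
      (Complex.Gamma (2 ^ (p + 1) * x - k - Complex.I) /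
        Complex.Gamma (2 ^ (p + 1) * x - k + Complex.I)) *
      ((2 ^ (p + 1))⁻¹ * (x - (k + 1 + Complex.I) / 2 ^ (p + 1))⁻¹) *
      (∏ l ∈ Finset.range p, (Complex.sin (π * (Complex.I + 2 ^ (l + 1) * x)) /
        Complex.sin (π * (Complex.I - 2 ^ (l + 1) * x)))) * hzero
  have him : ∀ (q : ℕ) (z : ℂ), ((2 : ℂ) ^ q * z).im = 2 ^ q * z.im := fun q z => by
    rw [← Complex.im_ofReal_mul]
    push_cast
    rfl
  have hnonpos : ∀ (q : ℕ) {z : ℂ}, z.im ≤ 0 → (2 : ℝ) ^ q * z.im ≤ 0 := fun q {z} hz =>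
    mul_nonpos_of_nonneg_of_nonpos (by positivity) hz
  simp only [hpoint]
  refine integral_mul_inv_sub_mul_inv_sub_eq_zero (C := ‖c‖) (by simp) ?_
    (fun z hz => ?_) fun z hz => ?_
  · have h := him (p + 1) ((k + 1 + Complex.I) / 2 ^ (p + 1))
    rw [mul_div_cancel₀ _ htwo] at h
    refine pos_of_mul_pos_right (a := (2 : ℝ) ^ (p + 1)) ?_ (by positivity)
    rw [← h]
    simp
  · have hinv : Differentiable ℂ fun w : ℂ => (Complex.Gamma w)⁻¹ :=
      Complex.differentiable_one_div_Gamma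
    have h₁ : DifferentiableAt ℂ (fun z : ℂ => Complex.Gamma (2 - (z - j) + Complex.I)) z :=
      (differentiableAt_Gamma_of_im_ne_zero (by simp; linarith)).comp z (by fun_prop)
    have h₂ : DifferentiableAt ℂ
        (fun z : ℂ => Complex.Gamma (2 ^ (p + 1) * z - k - Complex.I)) z :=
      (differentiableAt_Gamma_of_im_ne_zero (by
        have := hnonpos (p + 1) hz
        simp [him]
        linarith)).comp z (by fun_prop)
    have h₃ : DifferentiableAt ℂ
        (fun z : ℂ => (Complex.Gamma (2 - (z - j) - Complex.I))⁻¹) z :=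
      hinv.differentiableAt.comp z (by fun_prop)
    have h₄ : DifferentiableAt ℂ
        (fun z : ℂ => (Complex.Gamma (2 ^ (p + 1) * z - k + Complex.I))⁻¹) z :=
      hinv.differentiableAt.comp z (by fun_prop)
    simp only [hg, div_eq_mul_inv (Complex.Gamma _)]
    refine (((h₁.mul h₃).mul (h₂.mul h₄)).mul
      (DifferentiableAt.fun_finsetProd fun l _ => ?_)).const_mul c
    refine DifferentiableAt.div (by fun_prop) (by fun_prop) (sin_pi_mul_ne_zero_of_im_ne_zero ?_)
    have := hnonpos (l + 1) hz
    rw [Complex.sub_im, him, Complex.I_im]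
    linarith
  · simp only [hg]
    rw [norm_mul]
    refine mul_le_of_le_one_right (norm_nonneg _) ?_
    rw [norm_mul, norm_mul, norm_prod]
    refine mul_le_one₀ (mul_le_one₀ ?_ (norm_nonneg _) ?_)
      (Finset.prod_nonneg fun _ _ => norm_nonneg _)
      (Finset.prod_le_one (fun _ _ => norm_nonneg _) fun l _ => ?_)
    · refine norm_Gamma_div_Gamma_le_one (by simp) (sq_le_sq.1 ?_)
      simp
      nlinarith
    · refine norm_Gamma_div_Gamma_le_one (by simp) (sq_le_sq.1 ?_)
      have := hnonpos (p + 1) hz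
      simp only [Complex.add_im, Complex.sub_im, him, Complex.I_im, Complex.intCast_im]
      nlinarith
    · have := hnonpos (l + 1) hz
      refine norm_sin_div_sin_le_one ?_ (sq_le_sq.1 ?_)
      · simp only [Complex.re_ofReal_mul, Complex.add_re, Complex.sub_re, Complex.I_re, zero_add,
          zero_sub, mul_neg, abs_neg]
      · simp only [Complex.im_ofReal_mul, Complex.add_im, Complex.sub_im, him, Complex.I_im]
        rw [mul_pow, mul_pow]
        gcongr ?_ * ?_
        nlinarith

/-- The multiscale system `2^{n/2} φ(2^n x − j) ℬ(2^n x)`. -/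
noncomputable def multiscaleWavelet (n j : ℤ) (x : ℝ) : ℂ :=
  ((2 : ℝ) ^ ((n : ℝ) / 2) : ℝ) * gammaWavelet ((2 : ℝ) ^ n * x - j) *
    sineProduct ((2 : ℝ) ^ n * x)

theorem integral_multiscaleWavelet_mul_conj_add_natCast (n j k : ℤ) (p : ℕ) :
    ∫ x : ℝ, multiscaleWavelet n j x * (starRingEnd ℂ) (multiscaleWavelet (n + p) k x) =
      (((2 : ℝ) ^ ((n : ℝ) / 2) * (2 : ℝ) ^ (((n + p : ℤ) : ℝ) / 2) * ((2 : ℝ) ^ n)⁻¹ : ℝ) : ℂ) *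
        ∫ x : ℝ, gammaWavelet (x - j) * sineProduct x * (starRingEnd ℂ)
          (gammaWavelet (2 ^ p * x - k) * sineProduct (2 ^ p * x)) := by
  have hscale := Measure.integral_comp_mul_left (fun x : ℝ => gammaWavelet (x - j) *
    sineProduct x * (starRingEnd ℂ)
      (gammaWavelet (2 ^ p * x - k) * sineProduct (2 ^ p * x))) ((2 : ℝ) ^ n)
  rw [abs_of_pos (by positivity), Complex.real_smul] at hscale
  rw [Complex.ofReal_mul, mul_assoc, ← hscale, ← integral_const_mul]
  congr 1 with x
  have hpow : (2 : ℝ) ^ (n + p : ℤ) * x = 2 ^ p * (2 ^ n * x) := by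
    rw [zpow_add₀ two_ne_zero, zpow_natCast]
    ring
  simp only [multiscaleWavelet, hpow, map_mul, Complex.conj_ofReal, Complex.ofReal_mul]
  ring

theorem integral_multiscaleWavelet_mul_conj_same_scale (n j k : ℤ) :
    ∫ x : ℝ, multiscaleWavelet n j x * (starRingEnd ℂ) (multiscaleWavelet n k x) =
      if j = k then 1 else 0 := by
  have h := integral_multiscaleWavelet_mul_conj_add_natCast n j k 0
  have hcoeff : (2 : ℝ) ^ ((n : ℝ) / 2) * (2 : ℝ) ^ ((n : ℝ) / 2) * ((2 : ℝ) ^ n)⁻¹ = 1 := by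
    rw [← Real.rpow_add two_pos, add_halves, Real.rpow_intCast]
    exact mul_inv_cancel₀ (by positivity)
  simp only [Nat.cast_zero, add_zero, pow_zero, one_mul, hcoeff, Complex.ofReal_one] at h
  rw [h, ← integral_gammaWavelet_sub_mul_conj j k]
  congr 1 with x
  have hunit : sineProduct x * (starRingEnd ℂ) (sineProduct x) = 1 := by
    simpa using sineProduct_mul_conj_two_pow_mul 0 x
  rw [map_mul, mul_mul_mul_comm, hunit, mul_one]

theorem integral_multiscaleWavelet_mul_conj_of_lt {n m : ℤ} (hnm : n < m) (j k : ℤ) :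
    ∫ x : ℝ, multiscaleWavelet n j x * (starRingEnd ℂ) (multiscaleWavelet m k x) = 0 := by
  obtain ⟨p, hp⟩ := Int.le.dest (Int.add_one_le_of_lt hnm)
  obtain rfl : m = n + (p + 1 : ℕ) := by
    push_cast
    lia
  rw [integral_multiscaleWavelet_mul_conj_add_natCast,
    integral_gammaWavelet_mul_sineProduct_mul_conj_two_pow_eq_zero, mul_zero]

/-- The multiscale wavelet family
`φ_{n,j}(x) = 2^{n/2} φ(2^n x − j) ℬ(2^n x)`, where
`φ(x) = Γ(x−1+i)/(√π Γ(x−i))`, `ℬ(x) = ∏_{j ≤ -1} G(2^j x)` and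
`G(x) = sin(π(i−x))/sin(π(i+x))`, is orthonormal in `L²(ℝ)`. -/
theorem multiscale_wavelets_orthonormal
    (G : ℝ → ℂ)
    (hG : ∀ x : ℝ, G x =
      Complex.sin (π * (Complex.I - x)) / Complex.sin (π * (Complex.I + x)))
    (ℬ : ℝ → ℂ)
    (hℬ : ∀ x : ℝ, ℬ x = ∏' j : {j : ℤ // j ≤ -1}, G ((2 : ℝ) ^ (j : ℤ) * x))
    (φ : ℝ → ℂ)
    (hφ : ∀ x : ℝ, φ x = Complex.Gamma ((x : ℂ) - 1 + Complex.I) /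
      ((Real.sqrt π : ℂ) * Complex.Gamma ((x : ℂ) - Complex.I)))
    (Φ : ℤ → ℤ → ℝ → ℂ)
    (hΦ : ∀ (n j : ℤ) (x : ℝ), Φ n j x =
      ((2 : ℝ) ^ ((n : ℝ) / 2) : ℝ) * φ ((2 : ℝ) ^ n * x - j) * ℬ ((2 : ℝ) ^ n * x)) :
    ∀ n j m k : ℤ, ∫ x : ℝ, Φ n j x * (starRingEnd ℂ) (Φ m k x) =
      if (n, j) = (m, k) then (1 : ℂ) else 0 := by
  obtain rfl : G = sineQuotient := funext hG
  obtain rfl : ℬ = sineProduct := funext hℬ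
  obtain rfl : φ = gammaWavelet := funext hφ
  obtain rfl : Φ = multiscaleWavelet := funext fun n => funext fun j => funext (hΦ n j)
  intro n j m k
  rcases lt_trichotomy n m with h | rfl | h
  · rw [integral_multiscaleWavelet_mul_conj_of_lt h, if_neg (by simp [h.ne])]
  · simp [integral_multiscaleWavelet_mul_conj_same_scale]
  · rw [integral_mul_conj_swap, integral_multiscaleWavelet_mul_conj_of_lt h, map_zero,
      if_neg (by simp [h.ne'])]
end

section
/- Let B(x) = sin(π(i − 1/x))/sin(π(i + 1/x)) for real x ≠ 0. Then for every real x ≠ 0 the series ∑_{n ≥ 0} (−1)^n e^{−2πn} B(x)^{n+1} converges, and exp(2πi/x) = e^{−2π} + (1 − e^{−4π}) · ∑_{n ≥ 0} (−1)^n e^{−2πn} B(x)^{n+1}. -/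
open Real

theorem sin_pi_mul_I_sub_div_sin_pi_mul_I_add (t : ℂ) :
    Complex.sin (π * (Complex.I - t)) / Complex.sin (π * (Complex.I + t)) =
      (Complex.exp (2 * π * Complex.I * t) - Complex.exp (-2 * π)) /
        (1 - Complex.exp (-2 * π) * Complex.exp (2 * π * Complex.I * t)) := by
  have hc : Complex.I / 2 * Complex.exp (π - π * Complex.I * t) ≠ 0 := by
    simp [Complex.exp_ne_zero]
  rw [← mul_div_mul_left (Complex.exp (2 * π * Complex.I * t) - _) _ hc]
  congr 1
  · rw [Complex.sin, mul_assoc (Complex.I / 2), mul_sub (Complex.exp _),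
      ← Complex.exp_add, ← Complex.exp_add]
    ring_nf
    simp only [Complex.I_sq]
    ring_nf
  · rw [Complex.sin, ← Complex.exp_add, mul_assoc (Complex.I / 2), mul_sub (Complex.exp _), mul_one,
      ← Complex.exp_add]
    ring_nf
    simp only [Complex.I_sq]
    ring_nf

/-- A disc automorphism with real parameter maps the unit circle to itself. -/
theorem norm_sub_div_one_sub_mul_of_norm_eq_one {w : ℂ} (hw : ‖w‖ = 1) {q : ℝ}
    (hq : 1 - (q : ℂ) * w ≠ 0) : ‖(w - q) / (1 - q * w)‖ = 1 := by
  have hww : w * (starRingEnd ℂ) w = 1 := by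
    simp [Complex.mul_conj, Complex.normSq_eq_norm_sq, hw]
  have h : 1 - (q : ℂ) * w = w * (starRingEnd ℂ) (w - q) := by
    rw [map_sub, Complex.conj_ofReal, mul_sub, hww, mul_comm w]
  have hn : ‖1 - (q : ℂ) * w‖ = ‖w - q‖ := by
    rw [h, norm_mul, hw, one_mul, RCLike.norm_conj]
  rw [norm_div, ← hn, div_self (norm_ne_zero_iff.mpr hq)]

/-- The explicit unwinding series of the singular inner function
`exp(2πi/x)`: with `B(x) = sin(π(i − 1/x))/sin(π(i + 1/x))`, for every real `x ≠ 0`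
the series `∑_{n≥0} (−1)ⁿ e^{−2πn} B(x)^{n+1}` converges and
`exp(2πi/x) = e^{−2π} + (1 − e^{−4π}) ∑_{n≥0} (−1)ⁿ e^{−2πn} B(x)^{n+1}`. -/
theorem unwinding_series_exp
    (B : ℝ → ℂ)
    (hB : ∀ x : ℝ, x ≠ 0 → B x =
      Complex.sin (π * (Complex.I - 1 / (x : ℂ))) /
        Complex.sin (π * (Complex.I + 1 / (x : ℂ)))) :
    ∀ x : ℝ, x ≠ 0 →
      Summable (fun n : ℕ =>
        (-1 : ℂ) ^ n * (Real.exp (-2 * π * n) : ℂ) * B x ^ (n + 1)) ∧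
      Complex.exp (2 * π * Complex.I / (x : ℂ)) =
        (Real.exp (-2 * π) : ℂ) + (1 - (Real.exp (-4 * π) : ℂ)) *
          ∑' n : ℕ, (-1 : ℂ) ^ n * (Real.exp (-2 * π * n) : ℂ) * B x ^ (n + 1) := by
  intro x hx
  set q : ℝ := Real.exp (-2 * π) with hq
  set w : ℂ := Complex.exp (2 * π * Complex.I / (x : ℂ)) with hw
  have hq0 : 0 < q := Real.exp_pos _
  have hq1 : q < 1 := Real.exp_lt_one_iff.mpr (by linarith [Real.pi_pos])
  have hw1 : ‖w‖ = 1 := by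
    rw [hw, show 2 * (π : ℂ) * Complex.I / x = ((2 * π / x : ℝ) : ℂ) * Complex.I by
      push_cast; ring, Complex.norm_exp_ofReal_mul_I]
  have hden : 1 - (q : ℂ) * w ≠ 0 := by
    intro h
    have := congrArg norm (sub_eq_zero.mp h)
    rw [norm_one, norm_mul, hw1, Complex.norm_of_nonneg hq0.le] at this
    linarith
  have hBx : B x = (w - q) / (1 - q * w) := by
    rw [hB x hx, sin_pi_mul_I_sub_div_sin_pi_mul_I_add, hq, hw, mul_one_div]
    push_cast
    rfl
  have hr : ‖-(q : ℂ) * B x‖ < 1 := by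
    rwa [norm_mul, norm_neg, hBx, norm_sub_div_one_sub_mul_of_norm_eq_one hw1 hden, mul_one,
      Complex.norm_of_nonneg hq0.le]
  have hterm : (fun n : ℕ => (-1 : ℂ) ^ n * (Real.exp (-2 * π * n) : ℂ) * B x ^ (n + 1)) =
      fun n : ℕ => B x * (-(q : ℂ) * B x) ^ n := by
    funext n
    rw [mul_comm (-2 * π) (n : ℝ), Real.exp_nat_mul, ← hq, mul_pow, neg_pow (q : ℂ)]
    push_cast
    ring
  have hsum := (hasSum_geometric_of_norm_lt_one hr).mul_left (B x)
  have hq4 : Real.exp (-4 * π) = q ^ 2 := by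
    rw [hq, ← Real.exp_nat_mul]
    congr 1
    push_cast
    ring
  have hq2 : (1 : ℂ) - (q : ℂ) ^ 2 ≠ 0 := by
    have : (1 : ℝ) - q ^ 2 ≠ 0 := by nlinarith
    exact_mod_cast this
  have hB1 : 1 - -(q : ℂ) * B x = (1 - (q : ℂ) ^ 2) / (1 - q * w) := by
    rw [hBx]
    field_simp
    ring
  rw [hterm, hsum.tsum_eq, hq4, hB1, hBx]
  refine ⟨by simpa only [hBx] using hsum.summable, ?_⟩
  rw [inv_div, div_mul_div_cancel₀ hden, Complex.ofReal_pow, mul_div_cancel₀ _ hq2]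
  ring
end

section
/- Let f : ℝ² → ℂ be a Schwartz function, let θ ∈ ℝ, write θ⃗ = (cos θ, sin θ) and θ⃗^⊥ = (−sin θ, cos θ), and define the Radon transform R_θ f(t) = ∫_ℝ f(t θ⃗ + s θ⃗^⊥) ds. Then for every complex z with Im z > 0, ∫_0^∞ e^{2πirz} f̂(r θ⃗) r dr = −(1/(4π²)) ∫_ℝ R_θ f(t)/(t − z)² dt, where f̂(ξ) = ∫_{ℝ²} f(x) e^{−2πi x·ξ} dx is the Fourier transform of f. -/
open MeasureTheory Real

/-- Rotation of the plane by the angle `θ` preserves Lebesgue measure. -/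
theorem measurePreserving_rotation (θ : ℝ) :
    MeasurePreserving (fun p : ℝ × ℝ =>
      (p.1 * Real.cos θ - p.2 * Real.sin θ, p.1 * Real.sin θ + p.2 * Real.cos θ)) := by
  refine ⟨by fun_prop, ?_⟩
  set L := Matrix.toLin (Module.Basis.finTwoProd ℝ) (Module.Basis.finTwoProd ℝ)
    !![Real.cos θ, -Real.sin θ; Real.sin θ, Real.cos θ] with hL
  have hdet : LinearMap.det L = 1 := by
    rw [hL, LinearMap.det_toLin, Matrix.det_fin_two_of]
    nlinarith [Real.sin_sq_add_cos_sq θ]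
  have hfun : (fun p : ℝ × ℝ =>
      (p.1 * Real.cos θ - p.2 * Real.sin θ, p.1 * Real.sin θ + p.2 * Real.cos θ)) = L := by
    funext p
    rw [hL, Matrix.toLin_finTwoProd_apply]
    ext <;> ring
  rw [hfun, Measure.map_linearMap_addHaar_eq_smul_addHaar volume (by simp [hdet])]
  simp [hdet]

theorem measurableEmbedding_rotation (θ : ℝ) :
    MeasurableEmbedding (fun p : ℝ × ℝ =>
      (p.1 * Real.cos θ - p.2 * Real.sin θ, p.1 * Real.sin θ + p.2 * Real.cos θ)) := by
  refine Continuous.measurableEmbedding (by fun_prop) fun p q h => ?_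
  obtain ⟨h1, h2⟩ := Prod.mk.inj h
  have := Real.sin_sq_add_cos_sq θ
  ext
  · linear_combination Real.cos θ * h1 + Real.sin θ * h2 - (p.1 - q.1) * this
  · linear_combination -Real.sin θ * h1 + Real.cos θ * h2 - (p.2 - q.2) * this

theorem integrableOn_mul_exp_neg_mul {b : ℝ} (hb : 0 < b) :
    IntegrableOn (fun r : ℝ => r * Real.exp (-b * r)) (Set.Ioi 0) := by
  simpa using integrableOn_rpow_mul_exp_neg_mul_rpow (s := 1) (p := 1) (by norm_num) one_pos hb

theorem norm_mul_cexp_neg_mul {w : ℂ} {r : ℝ} (hr : 0 ≤ r) :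
    ‖(r : ℂ) * Complex.exp (-w * r)‖ = r * Real.exp (-w.re * r) := by
  simp [Complex.norm_exp, abs_of_nonneg hr]

theorem integrableOn_mul_cexp_neg_mul {w : ℂ} (hw : 0 < w.re) :
    IntegrableOn (fun r : ℝ => (r : ℂ) * Complex.exp (-w * r)) (Set.Ioi 0) := by
  refine (integrableOn_mul_exp_neg_mul hw).mono' (by fun_prop) ?_
  filter_upwards [ae_restrict_mem measurableSet_Ioi] with r hr
  exact (norm_mul_cexp_neg_mul (le_of_lt hr)).le

/-- The Laplace transform of `r ↦ r` at a complex point of positive real part. -/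
theorem integral_mul_cexp_neg_mul {w : ℂ} (hw : 0 < w.re) :
    ∫ r in Set.Ioi (0 : ℝ), (r : ℂ) * Complex.exp (-w * r) = 1 / w ^ 2 := by
  have hw0 : w ≠ 0 := by rintro rfl; simp at hw
  have hderiv : ∀ r ∈ Set.Ici (0 : ℝ),
      HasDerivAt (fun r : ℝ => -(1 / w) * ((r : ℂ) * Complex.exp (-w * r)) -
        1 / w ^ 2 * Complex.exp (-w * r)) ((r : ℂ) * Complex.exp (-w * r)) r := by
    intro r _
    have hid : HasDerivAt (fun r : ℝ => (r : ℂ)) 1 r := Complex.ofRealCLM.hasDerivAt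
    have hexp := (hid.const_mul (-w)).cexp
    refine (((hid.mul hexp).const_mul (-(1 / w))).sub
      (hexp.const_mul (1 / w ^ 2))).congr_deriv ?_
    field_simp
    ring
  have hlin : Filter.Tendsto (fun r : ℝ => (r : ℂ) * Complex.exp (-w * r))
      Filter.atTop (nhds 0) := by
    rw [tendsto_zero_iff_norm_tendsto_zero]
    have h := tendsto_rpow_mul_exp_neg_mul_atTop_nhds_zero 1 w.re hw
    refine h.congr' ?_
    filter_upwards [Filter.eventually_ge_atTop 0] with r hr
    rw [norm_mul_cexp_neg_mul hr, Real.rpow_one]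
  have hexp : Filter.Tendsto (fun r : ℝ => Complex.exp (-w * r)) Filter.atTop (nhds 0) := by
    rw [tendsto_zero_iff_norm_tendsto_zero]
    have h := tendsto_rpow_mul_exp_neg_mul_atTop_nhds_zero 0 w.re hw
    refine h.congr fun r => ?_
    simp [Complex.norm_exp]
  have hlim := (hlin.const_mul (-(1 / w))).sub (hexp.const_mul (1 / w ^ 2))
  rw [integral_Ioi_of_hasDerivAt_of_tendsto' hderiv (integrableOn_mul_cexp_neg_mul hw) hlim]
  simp

/-- For a Schwartz function `f` on `ℝ²`, direction `θ⃗ = (cos θ, sin θ)`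
and Radon transform `R_θ f(t) = ∫ f(t θ⃗ + s θ⃗^⊥) ds`, the `θ`-holomorphic function
`F_θ(z) = ∫_0^∞ e^{2πirz} f̂(rθ⃗) r dr` satisfies, for `Im z > 0`,
`F_θ(z) = −(1/4π²) ∫ R_θ f(t)/(t − z)² dt`. -/
theorem radon_cauchy_representation
    (f : SchwartzMap (ℝ × ℝ) ℂ) (θ : ℝ)
    (hatf : ℝ × ℝ → ℂ)
    (hhat : ∀ ξ : ℝ × ℝ, hatf ξ = ∫ x : ℝ × ℝ, f x *
      Complex.exp (-2 * π * Complex.I * ((x.1 * ξ.1 + x.2 * ξ.2 : ℝ) : ℂ)))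
    (R : ℝ → ℂ)
    (hR : ∀ t : ℝ, R t = ∫ s : ℝ,
      f (t * Real.cos θ - s * Real.sin θ, t * Real.sin θ + s * Real.cos θ)) :
    ∀ z : ℂ, 0 < z.im →
      ∫ r in Set.Ioi (0 : ℝ), Complex.exp (2 * π * Complex.I * r * z) *
          hatf (r * Real.cos θ, r * Real.sin θ) * (r : ℂ) =
        -(1 / (4 * (π : ℂ) ^ 2)) * ∫ t : ℝ, R t / ((t : ℂ) - z) ^ 2 := by
  intro z hz
  set g : ℝ × ℝ → ℂ := fun p =>
    f (p.1 * Real.cos θ - p.2 * Real.sin θ, p.1 * Real.sin θ + p.2 * Real.cos θ) with hg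
  have hrot := measurePreserving_rotation θ
  have hemb := measurableEmbedding_rotation θ
  have hgint : Integrable g :=
    hrot.integrable_comp_of_integrable (f.integrable (μ := volume))
  set w : ℝ → ℂ := fun t => 2 * π * Complex.I * (t - z) with hw
  have hwre : ∀ t, (w t).re = 2 * π * z.im := fun t => by simp [hw]
  have hwpos : ∀ t, 0 < (w t).re := fun t => by rw [hwre]; positivity
  have hhat' : ∀ r : ℝ, hatf (r * Real.cos θ, r * Real.sin θ) =
      ∫ p, g p * Complex.exp (-2 * π * Complex.I * (r * p.1 : ℝ)) := by
    intro r
    rw [hhat, ← hrot.integral_comp hemb]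
    refine integral_congr_ae (.of_forall fun p => ?_)
    have hdot : (p.1 * Real.cos θ - p.2 * Real.sin θ) * (r * Real.cos θ) +
        (p.1 * Real.sin θ + p.2 * Real.cos θ) * (r * Real.sin θ) = r * p.1 := by
      linear_combination r * p.1 * Real.sin_sq_add_cos_sq θ
    simp only [hg, hdot]
  have hF : Integrable (fun q : ℝ × (ℝ × ℝ) => (q.1 : ℂ) * Complex.exp (-w q.2.1 * q.1) * g q.2)
      ((volume.restrict (Set.Ioi 0)).prod volume) := by
    have hpos : 0 < 2 * π * z.im := by positivity
    have hmaj := (integrableOn_mul_exp_neg_mul hpos).mul_prod hgint.norm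
    refine hmaj.mono' ?_ ?_
    · refine AEStronglyMeasurable.mul ?_ hgint.1.comp_snd
      exact Continuous.aestronglyMeasurable (by fun_prop)
    · have hmem : ∀ᵐ q ∂((volume.restrict (Set.Ioi (0 : ℝ))).prod (volume : Measure (ℝ × ℝ))),
          q.1 ∈ Set.Ioi (0 : ℝ) :=
        Measure.quasiMeasurePreserving_fst.ae (ae_restrict_mem measurableSet_Ioi)
      filter_upwards [hmem] with q hq
      rw [norm_mul, norm_mul_cexp_neg_mul (le_of_lt hq), hwre]
  have hkernel : ∀ t, 1 / w t ^ 2 = -(1 / (4 * (π : ℂ) ^ 2)) * (1 / ((t : ℂ) - z) ^ 2) := by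
    intro t
    have hsq : w t ^ 2 = -(4 * (π : ℂ) ^ 2 * ((t : ℂ) - z) ^ 2) := by
      simp only [hw]
      linear_combination (4 * (π : ℂ) ^ 2 * ((t : ℂ) - z) ^ 2) * Complex.I_sq
    rw [hsq, one_div_neg_eq_neg_one_div, neg_mul, one_div_mul_one_div]
  have hG : Integrable (fun p : ℝ × ℝ => 1 / w p.1 ^ 2 * g p) := by
    refine hF.integral_prod_right.congr (.of_forall fun p => ?_)
    simp only [integral_mul_const, integral_mul_cexp_neg_mul (hwpos _)]
  calc
    _ = ∫ r in Set.Ioi (0 : ℝ), ∫ p : ℝ × ℝ, (r : ℂ) * Complex.exp (-w p.1 * r) * g p := by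
      refine integral_congr_ae (.of_forall fun r => ?_)
      simp only
      rw [hhat', mul_right_comm, ← integral_const_mul]
      refine integral_congr_ae (.of_forall fun p => ?_)
      have hexp : Complex.exp (-w p.1 * r) = Complex.exp (2 * π * Complex.I * r * z) *
          Complex.exp (-2 * π * Complex.I * (r * p.1 : ℝ)) := by
        rw [← Complex.exp_add]
        congr 1
        simp only [hw]
        push_cast
        ring
      simp only [hexp]
      ring
    _ = ∫ p : ℝ × ℝ, 1 / w p.1 ^ 2 * g p := by
      rw [integral_integral_swap hF]
      simp only [integral_mul_const, integral_mul_cexp_neg_mul (hwpos _)]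
    _ = ∫ t : ℝ, 1 / w t ^ 2 * R t := by
      rw [Measure.volume_eq_prod, integral_prod _ hG]
      simp only [integral_const_mul, hR, hg]
    _ = _ := by
      rw [← integral_const_mul]
      refine integral_congr_ae (.of_forall fun t => ?_)
      simp only [hkernel]
      ring
end

section
/- Let f : ℝ² → ℂ be a Schwartz function and for θ ∈ ℝ define F_θ(z) = ∫_0^∞ e^{2πirz} f̂(r θ⃗) r dr for Im z > 0, where θ⃗ = (cos θ, sin θ) and f̂(ξ) = ∫_{ℝ²} f(x) e^{−2πi x·ξ} dx. Then 4π ∫_0^{2π} ∫_0^∞ ∫_ℝ |F_θ(t + iy)|² dt dy dθ = ∫_{ℝ²} |f(x)|² dx. -/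
open MeasureTheory Real

open scoped FourierTransform SchwartzMap ContDiff in
/-- Plancherel's theorem for the Fourier integral of an `L¹ ∩ L²` function. -/
theorem integral_norm_sq_fourier_of_integrable_of_memLp {V H : Type*} [NormedAddCommGroup V]
    [InnerProductSpace ℝ V] [FiniteDimensional ℝ V] [MeasurableSpace V] [BorelSpace V]
    [NormedAddCommGroup H] [InnerProductSpace ℂ H] [CompleteSpace H] {g : V → H}
    (hg : Integrable g) (hg2 : MemLp g 2) :
    ∫ ξ, ‖𝓕 g ξ‖ ^ 2 = ∫ x, ‖g x‖ ^ 2 := by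
  have hae : ∀ᵐ ξ, (𝓕 (hg2.toLp g) : Lp H 2 (volume : Measure V)) ξ = 𝓕 g ξ := by
    apply ae_eq_of_integral_contDiff_smul_eq
    · exact (Lp.memLp _).locallyIntegrable (by norm_num)
    · exact (VectorFourier.fourierIntegral_continuous continuous_fourierChar
        (L := innerₗ V) continuous_inner hg).locallyIntegrable
    · intro φ φ_smooth φ_cpt
      have h₁ : HasCompactSupport (Complex.ofRealCLM ∘ φ) := φ_cpt.comp_left rfl
      have h₂ : ContDiff ℝ ∞ (Complex.ofRealCLM ∘ φ) := by fun_prop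
      let ψ : 𝓢(V, ℂ) := h₁.toSchwartzMap h₂
      have hψ : ∀ x, ψ x = φ x := fun x ↦ rfl
      have hdist := DFunLike.congr_fun (Lp.fourier_toTemperedDistribution_eq (hg2.toLp g)) ψ
      rw [TemperedDistribution.fourier_apply, Lp.toTemperedDistribution_apply,
        Lp.toTemperedDistribution_apply] at hdist
      calc
        _ = ∫ x, ψ x • (𝓕 (hg2.toLp g) : Lp H 2 (volume : Measure V)) x := by simp [hψ]
        _ = ∫ x, 𝓕 ψ x • (hg2.toLp g) x := hdist.symm
        _ = ∫ x, 𝓕 ψ x • g x := by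
          refine integral_congr_ae ?_
          filter_upwards [hg2.coeFn_toLp] with x hx
          rw [hx]
        _ = ∫ x, ψ x • 𝓕 g x := by
          simpa using! VectorFourier.integral_fourierIntegral_smul_eq_flip (L := innerₗ V)
            continuous_fourierChar continuous_inner ψ.integrable hg
        _ = _ := by simp [hψ]
  have hsq : ∀ u : Lp H 2 (volume : Measure V), ∫ x, ‖u x‖ ^ 2 = ‖u‖ ^ 2 := fun u ↦ by
    apply Complex.ofRealLI.injective
    simpa [← LinearIsometry.integral_comp_comm, inner_self_eq_norm_sq_to_K] using
      (L2.inner_def (𝕜 := ℂ) u u).symm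
  calc
    _ = ∫ ξ, ‖(𝓕 (hg2.toLp g) : Lp H 2 (volume : Measure V)) ξ‖ ^ 2 := by
      refine integral_congr_ae ?_
      filter_upwards [hae] with x hx
      rw [hx]
    _ = ∫ x, ‖hg2.toLp g x‖ ^ 2 := by rw [hsq, hsq, Lp.norm_fourier_eq]
    _ = _ := by
      refine integral_congr_ae ?_
      filter_upwards [hg2.coeFn_toLp] with x hx
      rw [hx]

/-- The squared Bergman norm of a Laplace transform on the upper half-plane, for a density which is
the restriction to `(0, ∞)` of a Schwartz function vanishing at `0`. -/
theorem bergman_norm_sq_eq (h : SchwartzMap ℝ ℂ) :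
    ∫ y in Set.Ioi (0 : ℝ), ∫ t : ℝ, ‖∫ r in Set.Ioi (0 : ℝ),
      Complex.exp (2 * π * Complex.I * r * ((t : ℂ) + (y : ℂ) * Complex.I)) * h r * (r : ℂ)‖ ^ 2 =
    (4 * π)⁻¹ * ∫ r in Set.Ioi (0 : ℝ), r * ‖h r‖ ^ 2 := by
  let k : SchwartzMap ℝ ℂ := SchwartzMap.smulLeftCLM ℂ (fun r : ℝ ↦ r) h
  have hk : ∀ r, k r = r * h r := fun r ↦ by
    rw [← Complex.real_smul]
    exact SchwartzMap.smulLeftCLM_apply_apply (g := fun r : ℝ ↦ r) (by fun_prop) h r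
  have hplancherel : ∀ y ∈ Set.Ioi (0 : ℝ), ∫ t : ℝ, ‖∫ r in Set.Ioi (0 : ℝ),
      Complex.exp (2 * π * Complex.I * r * ((t : ℂ) + (y : ℂ) * Complex.I)) *
        h r * (r : ℂ)‖ ^ 2 =
      ∫ r in Set.Ioi (0 : ℝ), rexp (-(4 * π * r) * y) * ‖k r‖ ^ 2 := by
    intro y hy
    let g : ℝ → ℂ := (Set.Ioi 0).indicator fun r ↦ rexp (-(2 * π * r * y)) * k r
    have hgm : AEStronglyMeasurable g :=
      (AEStronglyMeasurable.indicator (by fun_prop) measurableSet_Ioi)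
    have hgk : ∀ᵐ r, ‖g r‖ ≤ ‖k r‖ := by
      refine .of_forall fun r ↦ ?_
      by_cases hr : r ∈ Set.Ioi (0 : ℝ)
      · simp only [g, Set.indicator_of_mem hr, norm_mul, Complex.norm_real, norm_eq_abs, abs_exp]
        refine mul_le_of_le_one_left (norm_nonneg _) (exp_le_one_iff.2 ?_)
        have := Set.mem_Ioi.1 hr
        have := Set.mem_Ioi.1 hy
        simp only [Left.neg_nonpos_iff]
        positivity
      · simp [g, Set.indicator_of_notMem hr]
    have hF : ∀ t : ℝ, ∫ r in Set.Ioi (0 : ℝ),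
        Complex.exp (2 * π * Complex.I * r * ((t : ℂ) + (y : ℂ) * Complex.I)) *
          h r * (r : ℂ) = FourierTransform.fourier g (-t) := by
      intro t
      rw [fourier_real_eq_integral_exp_smul, ← integral_indicator measurableSet_Ioi]
      refine integral_congr_ae (.of_forall fun r ↦ ?_)
      by_cases hr : r ∈ Set.Ioi (0 : ℝ)
      · simp only [g, Set.indicator_of_mem hr, hk, smul_eq_mul]
        rw [← mul_assoc, Complex.ofReal_exp, ← Complex.exp_add, mul_assoc, mul_comm (h r)]
        congr 2
        push_cast
        linear_combination (2 * π * r * y : ℂ) * Complex.I_sq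
      · simp [g, Set.indicator_of_notMem hr]
    simp_rw [hF]
    rw [integral_neg_eq_self (fun t ↦ ‖FourierTransform.fourier g t‖ ^ 2) volume,
      integral_norm_sq_fourier_of_integrable_of_memLp (k.integrable.mono hgm hgk)
        ((k.memLp 2 volume).mono hgm hgk), ← integral_indicator measurableSet_Ioi]
    refine integral_congr_ae (.of_forall fun r ↦ ?_)
    by_cases hr : r ∈ Set.Ioi (0 : ℝ)
    · simp only [g, Set.indicator_of_mem hr, norm_mul, Complex.norm_real, norm_eq_abs, abs_exp,
        mul_pow, ← exp_nat_mul]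
      congr 2
      push_cast
      ring
    · simp [g, Set.indicator_of_notMem hr]
  have hneg : ∀ r ∈ Set.Ioi (0 : ℝ), -(4 * π * r) < 0 := fun r hr ↦ by
    have := Set.mem_Ioi.1 hr
    simp only [Left.neg_neg_iff]
    positivity
  have hy : ∀ r ∈ Set.Ioi (0 : ℝ), ∫ y in Set.Ioi (0 : ℝ), rexp (-(4 * π * r) * y) * ‖k r‖ ^ 2 =
      (4 * π)⁻¹ * (r * ‖h r‖ ^ 2) := by
    intro r hr
    have hr' := Set.mem_Ioi.1 hr
    rw [integral_mul_const, integral_exp_mul_Ioi (hneg r hr), hk, norm_mul, Complex.norm_real,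
      norm_eq_abs, mul_pow, sq_abs]
    simp
    field_simp
  have hint : IntegrableOn (fun r ↦ (4 * π)⁻¹ * (r * ‖h r‖ ^ 2)) (Set.Ioi (0 : ℝ)) := by
    refine Integrable.integrableOn (.const_mul ?_ _)
    have := (k.integrable (μ := volume)).norm.mul_bdd (c := SchwartzMap.seminorm ℝ 0 0 h)
      (g := fun r ↦ ‖h r‖) (by fun_prop) (.of_forall fun r ↦ by
        simpa using h.norm_le_seminorm ℝ r)
    refine this.mono' (by fun_prop) (.of_forall fun r ↦ le_of_eq ?_)
    simp [hk]
    ring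
  rw [setIntegral_congr_fun measurableSet_Ioi hplancherel, integral_integral_swap,
    setIntegral_congr_fun measurableSet_Ioi hy, integral_const_mul]
  refine (integrable_prod_iff' ?_).2 ⟨?_, ?_⟩
  · exact Continuous.aestronglyMeasurable (by fun_prop)
  · filter_upwards [ae_restrict_mem measurableSet_Ioi] with r hr
    exact (integrableOn_exp_mul_Ioi (hneg r hr) 0).mul_const (‖k r‖ ^ 2)
  · refine hint.congr ?_
    filter_upwards [ae_restrict_mem measurableSet_Ioi] with r hr
    rw [← hy r hr]
    simp

/-- Bergman-norm isometry: for a Schwartz function `f` on `ℝ²` and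
`F_θ(z) = ∫_0^∞ e^{2πirz} f̂(rθ⃗) r dr`,
`4π ∫_0^{2π} ∫_0^∞ ∫_ℝ |F_θ(t+iy)|² dt dy dθ = ∫_{ℝ²} |f|²`. -/
theorem bergman_isometry
    (f : SchwartzMap (ℝ × ℝ) ℂ)
    (hatf : ℝ × ℝ → ℂ)
    (hhat : ∀ ξ : ℝ × ℝ, hatf ξ = ∫ x : ℝ × ℝ, f x *
      Complex.exp (-2 * π * Complex.I * ((x.1 * ξ.1 + x.2 * ξ.2 : ℝ) : ℂ)))
    (F : ℝ → ℂ → ℂ)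
    (hF : ∀ (θ : ℝ) (z : ℂ), F θ z = ∫ r in Set.Ioi (0 : ℝ),
      Complex.exp (2 * π * Complex.I * r * z) *
        hatf (r * Real.cos θ, r * Real.sin θ) * (r : ℂ)) :
    4 * π * ∫ θ in (0 : ℝ)..(2 * π), ∫ y in Set.Ioi (0 : ℝ), ∫ t : ℝ,
        ‖F θ ((t : ℂ) + (y : ℂ) * Complex.I)‖ ^ 2 =
      ∫ x : ℝ × ℝ, ‖f x‖ ^ 2 := by
  let fc : SchwartzMap ℂ ℂ :=
    SchwartzMap.compCLMOfContinuousLinearEquiv ℂ Complex.equivRealProdCLM f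
  let G : SchwartzMap ℂ ℂ := FourierTransform.fourier fc
  have hG : ∀ p : ℝ × ℝ, hatf (p.1 * cos p.2, p.1 * sin p.2) = G (Complex.polarCoord.symm p) := by
    intro p
    rw [hhat, SchwartzMap.fourier_coe, fourier_eq',
      ← Complex.volume_preserving_equiv_real_prod.integral_comp
        Complex.measurableEquivRealProd.measurableEmbedding]
    refine integral_congr_ae (.of_forall fun z ↦ ?_)
    rw [Complex.polarCoord_symm_apply]
    simp [fc, Complex.inner]
    rw [mul_comm]
    congr 2
    ring
  let J : ℝ → ℝ := fun θ ↦ ∫ r in Set.Ioi (0 : ℝ), r * ‖G (Complex.polarCoord.symm (r, θ))‖ ^ 2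
  have hinner : ∀ θ, ∫ y in Set.Ioi (0 : ℝ), ∫ t : ℝ,
      ‖F θ ((t : ℂ) + (y : ℂ) * Complex.I)‖ ^ 2 = (4 * π)⁻¹ * J θ := by
    intro θ
    let L : ℝ →L[ℝ] ℂ := ContinuousLinearMap.toSpanSingleton ℝ (Complex.polarCoord.symm (1, θ))
    have hL : ∀ r, L r = Complex.polarCoord.symm (r, θ) := fun r ↦ by
      simp [L, Complex.polarCoord_symm_apply, mul_add]
    have hLa : AntilipschitzWith 1 L := L.antilipschitz_of_bound fun r ↦ by
      rw [hL, Complex.norm_polarCoord_symm]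
      simp
    let h : SchwartzMap ℝ ℂ := SchwartzMap.compCLMOfAntilipschitz ℂ L.hasTemperateGrowth hLa G
    have hh : ∀ r, h r = G (Complex.polarCoord.symm (r, θ)) := fun r ↦ by simp [h, hL]
    have := bergman_norm_sq_eq h
    simp_rw [hh] at this
    simp_rw [hF, J, ← this, ← fun r ↦ hG (r, θ)]
  have hper : Function.Periodic J (2 * π) := fun θ ↦ by
    simp [J, Complex.polarCoord_symm_apply, Complex.cos_add_two_pi, Complex.sin_add_two_pi]
  have hGint : Integrable (fun z ↦ ‖G z‖ ^ 2) := by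
    exact (memLp_two_iff_integrable_sq_norm (by fun_prop)).1 (G.memLp 2 volume)
  have hpolar : IntegrableOn (fun p : ℝ × ℝ ↦ p.1 * ‖G (Complex.polarCoord.symm p)‖ ^ 2)
      polarCoord.target := by
    have hR : Integrable (fun x : ℝ × ℝ ↦ ‖G (Complex.measurableEquivRealProd.symm x)‖ ^ 2) :=
      (Complex.volume_preserving_equiv_real_prod.symm.integrable_comp_emb
        Complex.measurableEquivRealProd.symm.measurableEmbedding).2 hGint
    have := (integrableOn_image_iff_integrableOn_abs_det_fderiv_smul volume
      polarCoord.open_target.measurableSet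
      (fun p _ ↦ (hasFDerivAt_polarCoord_symm p).hasFDerivWithinAt)
      polarCoord.symm.injOn _).1 hR.integrableOn
    refine this.congr_fun (fun p hp ↦ ?_) polarCoord.open_target.measurableSet
    simp only [det_fderivPolarCoordSymm, smul_eq_mul, abs_of_pos (Set.mem_Ioi.1 hp.1)]
    rw [Complex.measurableEquivRealProd_symm_polarCoord_symm_apply]
  calc
    _ = ∫ θ in (0 : ℝ)..(2 * π), J θ := by
      simp_rw [hinner, intervalIntegral.integral_const_mul]
      field_simp
    _ = ∫ θ in (-π)..π, J θ := by
      have := hper.intervalIntegral_add_eq 0 (-π)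
      rw [zero_add] at this
      rw [this]
      congr 1
      ring
    _ = ∫ θ in Set.Ioo (-π) π, J θ := by
      rw [intervalIntegral.integral_of_le (by linarith [pi_pos]), integral_Ioc_eq_integral_Ioo]
    _ = ∫ p in polarCoord.target, p.1 * ‖G (Complex.polarCoord.symm p)‖ ^ 2 := by
      rw [polarCoord_target, Measure.volume_eq_prod, ← setIntegral_prod_swap, setIntegral_prod]
      · rfl
      · rw [polarCoord_target] at hpolar
        have := hpolar
        simp only [IntegrableOn, Measure.volume_eq_prod, ← Measure.prod_restrict] at this ⊢
        exact this.swap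
    _ = ∫ z, ‖G z‖ ^ 2 := Complex.integral_comp_polarCoord_symm fun z ↦ ‖G z‖ ^ 2
    _ = ∫ z, ‖fc z‖ ^ 2 := SchwartzMap.integral_norm_sq_fourier fc
    _ = _ := Complex.volume_preserving_equiv_real_prod.integral_comp
        Complex.measurableEquivRealProd.measurableEmbedding fun x ↦ ‖f x‖ ^ 2
end

section
/- Let f : ℝ² → ℂ be a Schwartz function and for θ ∈ ℝ and t ∈ ℝ define F_θ(t) = ∫_0^∞ e^{2πirt} f̂(r θ⃗) r dr, where θ⃗ = (cos θ, sin θ) and f̂(ξ) = ∫_{ℝ²} f(x) e^{−2πi x·ξ} dx. Then ∫_0^{2π} ∫_ℝ |F_θ(t)|² dt dθ = ∫_{ℝ²} |f̂(ξ)|² |ξ| dξ. -/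
open MeasureTheory Real

open scoped SchwartzMap FourierTransform ContDiff RealInnerProductSpace

section Plancherel

variable {V : Type*} [NormedAddCommGroup V] [InnerProductSpace ℝ V] [FiniteDimensional ℝ V]
  [MeasurableSpace V] [BorelSpace V]

/-- The `L²` Fourier transform of a function in `L¹ ∩ L²` is given by the Fourier integral. -/
theorem fourier_toLp_ae_eq {g : V → ℂ} (h1 : Integrable g) (h2 : MemLp g 2) :
    (𝓕 (h2.toLp g) : Lp ℂ 2 (volume : Measure V)) =ᵐ[volume] 𝓕 g := by
  have hcont : Continuous (𝓕 g) :=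
    VectorFourier.fourierIntegral_continuous Real.continuous_fourierChar
      (by exact continuous_inner) h1
  refine ae_eq_of_integral_contDiff_smul_eq
    ((Lp.memLp _).locallyIntegrable (by norm_num)) hcont.locallyIntegrable ?_
  intro φ hφ hφc
  have hc : HasCompactSupport (Complex.ofRealCLM ∘ φ) := hφc.comp_left rfl
  have hs : ContDiff ℝ ∞ (Complex.ofRealCLM ∘ φ) := by fun_prop
  set ψ : 𝓢(V, ℂ) := hc.toSchwartzMap hs with hψ
  have hψφ : ∀ x, ψ x = (φ x : ℂ) := fun x ↦ by simp [hψ]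
  have key := congrArg (fun T : 𝓢'(V, ℂ) ↦ T ψ)
    (Lp.fourier_toTemperedDistribution_eq (h2.toLp g))
  simp only [TemperedDistribution.fourier_apply, Lp.toTemperedDistribution_apply] at key
  have e1 : ∫ x, φ x • (𝓕 (h2.toLp g) : Lp ℂ 2 (volume : Measure V)) x =
      ∫ x, ψ x • (𝓕 (h2.toLp g) : Lp ℂ 2 (volume : Measure V)) x := by
    simp [hψφ]
  have e2 : ∫ x, φ x • 𝓕 g x = ∫ x, ψ x • 𝓕 g x := by simp [hψφ]
  rw [e1, e2, ← key]
  have e3 : ∫ x, (𝓕 ψ) x • (h2.toLp g) x = ∫ x, (𝓕 ψ) x • g x := by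
    refine integral_congr_ae ?_
    filter_upwards [h2.coeFn_toLp] with x hx
    rw [hx]
  rw [e3, SchwartzMap.fourier_coe]
  simpa using! VectorFourier.integral_fourierIntegral_smul_eq_flip (L := innerₗ V)
      Real.continuous_fourierChar continuous_inner ψ.integrable h1

theorem norm_sq_toLp_two {g : V → ℂ} (h2 : MemLp g 2) :
    ‖h2.toLp g‖ ^ 2 = ∫ x, ‖g x‖ ^ 2 := by
  have h := integral_congr_ae (μ := (volume : Measure V)) (f := fun x ↦ ‖h2.toLp g x‖ ^ 2)
    (g := fun x ↦ ‖g x‖ ^ 2) (by filter_upwards [h2.coeFn_toLp] with x hx; rw [hx])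
  rw [← h]
  apply Complex.ofRealLI.injective
  have := L2.inner_def (𝕜 := ℂ) (h2.toLp g) (h2.toLp g)
  simpa [← LinearIsometry.integral_comp_comm, inner_self_eq_norm_sq_to_K] using this

/-- Plancherel's theorem for functions in `L¹ ∩ L²`. -/
theorem integral_norm_sq_fourier_of_integrable {g : V → ℂ} (h1 : Integrable g) (h2 : MemLp g 2) :
    ∫ x, ‖𝓕 g x‖ ^ 2 = ∫ x, ‖g x‖ ^ 2 := by
  have hae := fourier_toLp_ae_eq h1 h2
  have h3 : MemLp (𝓕 g) 2 := (memLp_congr_ae hae).1 (Lp.memLp _)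
  have h4 : h3.toLp (𝓕 g) = 𝓕 (h2.toLp g) :=
    Lp.ext (h3.coeFn_toLp.trans hae.symm)
  rw [← norm_sq_toLp_two h3, ← norm_sq_toLp_two h2, h4, Lp.norm_fourier_eq]

/-- Plancherel's theorem for the inverse Fourier transform of functions in `L¹ ∩ L²`. -/
theorem integral_norm_sq_fourierInv_of_integrable {g : V → ℂ} (h1 : Integrable g)
    (h2 : MemLp g 2) : ∫ x, ‖𝓕⁻ g x‖ ^ 2 = ∫ x, ‖g x‖ ^ 2 := by
  simp_rw [Real.fourierInv_eq_fourier_neg]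
  rw [integral_neg_eq_self (fun x ↦ ‖𝓕 g x‖ ^ 2),
    integral_norm_sq_fourier_of_integrable h1 h2]

end Plancherel

/-- Plancherel's theorem on the half-line for `r ↦ r G(r e)`, where `G` is a Schwartz function
and `e` is a unit vector. -/
theorem integral_norm_sq_radial_fourierInv (G : 𝓢(ℂ, ℂ)) {e : ℂ} (he : ‖e‖ = 1) :
    ∫ t : ℝ, ‖∫ r in Set.Ioi (0 : ℝ),
      Complex.exp (2 * π * Complex.I * r * t) * G (r * e) * (r : ℂ)‖ ^ 2 =
      ∫ r in Set.Ioi (0 : ℝ), r * (‖G (r * e)‖ ^ 2 * r) := by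
  let L : ℝ →L[ℝ] ℂ := ContinuousLinearMap.toSpanSingleton ℝ e
  have hL : AntilipschitzWith 1 L := by
    refine AddMonoidHomClass.antilipschitz_of_bound L fun x ↦ ?_
    simp [L, he]
  let K : 𝓢(ℝ, ℂ) := SchwartzMap.smulLeftCLM ℂ (fun r : ℝ ↦ (r : ℂ))
    (SchwartzMap.compCLMOfAntilipschitz ℂ L.hasTemperateGrowth hL G)
  have hK : ∀ r : ℝ, K r = (r : ℂ) * G (r * e) := by
    intro r
    have : (fun r : ℝ ↦ (r : ℂ)).HasTemperateGrowth := Complex.ofRealCLM.hasTemperateGrowth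
    simp [K, SchwartzMap.smulLeftCLM_apply_apply this, SchwartzMap.compCLMOfAntilipschitz, L]
  have h1 : Integrable ((Set.Ioi (0 : ℝ)).indicator K) := K.integrable.indicator measurableSet_Ioi
  have h2 : MemLp ((Set.Ioi (0 : ℝ)).indicator K) 2 := (K.memLp 2).indicator measurableSet_Ioi
  have := integral_norm_sq_fourierInv_of_integrable h1 h2
  have hl : ∀ t : ℝ, 𝓕⁻ ((Set.Ioi (0 : ℝ)).indicator K) t = ∫ r in Set.Ioi (0 : ℝ),
      Complex.exp (2 * π * Complex.I * r * t) * G (r * e) * (r : ℂ) := by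
    intro t
    rw [Real.fourierInv_eq', ← integral_indicator measurableSet_Ioi]
    congr 1 with r
    by_cases hr : r ∈ Set.Ioi (0 : ℝ)
    · simp only [Set.indicator_of_mem hr, hK, smul_eq_mul]
      have : ((2 * π * ⟪r, t⟫ : ℝ) : ℂ) * Complex.I = 2 * π * Complex.I * r * t := by
        simp; ring
      rw [this]; ring
    · simp [Set.indicator_of_notMem hr]
  simp_rw [hl] at this
  rw [this, ← integral_indicator measurableSet_Ioi]
  congr 1 with r
  by_cases hr : r ∈ Set.Ioi (0 : ℝ)
  · simp only [Set.indicator_of_mem hr, hK, norm_mul, Complex.norm_real, mul_pow]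
    rw [Real.norm_eq_abs, sq_abs]; ring
  · simp [Set.indicator_of_notMem hr]

theorem integrableOn_comp_polarCoord_symm {f : ℝ × ℝ → ℝ} (hf : Integrable f) :
    IntegrableOn (fun p ↦ p.1 * f (polarCoord.symm p)) polarCoord.target := by
  have h := (integrableOn_image_iff_integrableOn_abs_det_fderiv_smul volume
    polarCoord.open_target.measurableSet
    (fun p _ ↦ (hasFDerivAt_polarCoord_symm p).hasFDerivWithinAt) polarCoord.symm.injOn f).1
    hf.integrableOn
  refine h.congr_fun (fun p hp ↦ ?_) polarCoord.open_target.measurableSet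
  simp only [det_fderivPolarCoordSymm, smul_eq_mul, abs_of_pos (show 0 < p.1 from hp.1)]

/-- Integration in polar coordinates as an iterated integral. -/
theorem integral_eq_integral_integral_polar {f : ℝ × ℝ → ℝ} (hf : Integrable f) :
    ∫ p, f p = ∫ θ in (-π)..π, ∫ r in Set.Ioi (0 : ℝ), r * f (r * cos θ, r * sin θ) := by
  have hi := integrableOn_comp_polarCoord_symm hf
  rw [← integral_comp_polarCoord_symm, intervalIntegral.integral_of_le (by linarith [pi_pos]),
    integral_Ioc_eq_integral_Ioo]
  simp only [polarCoord_target, IntegrableOn, Measure.volume_eq_prod, smul_eq_mul] at hi ⊢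
  rw [← Measure.prod_restrict] at hi ⊢
  rw [integral_prod_symm _ hi]
  simp

theorem SchwartzMap.integrable_norm_sq_mul_norm {V : Type*} [NormedAddCommGroup V]
    [NormedSpace ℝ V] [MeasurableSpace V] [BorelSpace V] [SecondCountableTopology V]
    (μ : Measure V) [μ.HasTemperateGrowth]
    (G : 𝓢(V, ℂ)) : Integrable (fun z ↦ ‖G z‖ ^ 2 * ‖z‖) μ := by
  obtain ⟨C, -, hC⟩ := G.decay 0 0
  refine ((G.integrable_pow_mul μ 1).mul_bdd (c := C) (f := fun z ↦ ‖z‖ ^ 1 * ‖G z‖)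
    (g := fun z ↦ ‖G z‖) G.continuous.norm.aestronglyMeasurable
    (Filter.Eventually.of_forall fun z ↦ by simpa using hC z)).congr
    (Filter.Eventually.of_forall fun z ↦ ?_)
  simp only
  ring

/-- Hardy-norm isometry: for a Schwartz function `f` on `ℝ²` and the
boundary values `F_θ(t) = ∫_0^∞ e^{2πirt} f̂(rθ⃗) r dr`,
`∫_0^{2π} ∫_ℝ |F_θ(t)|² dt dθ = ∫_{ℝ²} |f̂(ξ)|² |ξ| dξ`. -/
theorem hardy_isometry
    (f : SchwartzMap (ℝ × ℝ) ℂ)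
    (hatf : ℝ × ℝ → ℂ)
    (hhat : ∀ ξ : ℝ × ℝ, hatf ξ = ∫ x : ℝ × ℝ, f x *
      Complex.exp (-2 * π * Complex.I * ((x.1 * ξ.1 + x.2 * ξ.2 : ℝ) : ℂ)))
    (F : ℝ → ℝ → ℂ)
    (hF : ∀ (θ : ℝ) (t : ℝ), F θ t = ∫ r in Set.Ioi (0 : ℝ),
      Complex.exp (2 * π * Complex.I * r * t) *
        hatf (r * Real.cos θ, r * Real.sin θ) * (r : ℂ)) :
    ∫ θ in (0 : ℝ)..(2 * π), ∫ t : ℝ, ‖F θ t‖ ^ 2 =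
      ∫ ξ : ℝ × ℝ, ‖hatf ξ‖ ^ 2 * Real.sqrt (ξ.1 ^ 2 + ξ.2 ^ 2) := by
  let G : 𝓢(ℂ, ℂ) :=
    𝓕 (SchwartzMap.compCLMOfContinuousLinearEquiv ℂ Complex.equivRealProdCLM f)
  have hmp := Complex.volume_preserving_equiv_real_prod
  have hemb := Complex.measurableEquivRealProd.measurableEmbedding
  have hG : ∀ z : ℂ, hatf (z.re, z.im) = G z := by
    intro z
    rw [hhat, SchwartzMap.fourier_coe, Real.fourier_eq', ← hmp.integral_comp hemb]
    congr 1 with x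
    simp only [Complex.measurableEquivRealProd_apply, Complex.inner,
      SchwartzMap.compCLMOfContinuousLinearEquiv_apply, Function.comp_apply, smul_eq_mul,
      Complex.equivRealProdCLM_apply, Complex.mul_re, Complex.conj_re, Complex.conj_im]
    rw [mul_comm]
    congr 2
    push_cast
    ring
  have hpolar : ∀ r θ : ℝ, hatf (r * cos θ, r * sin θ) = G (r * Complex.exp (θ * Complex.I)) := by
    intro r θ
    rw [← hG]
    simp [Complex.exp_ofReal_mul_I_re, Complex.exp_ofReal_mul_I_im]
  have hint : Integrable (fun ξ : ℝ × ℝ ↦ ‖hatf ξ‖ ^ 2 * √(ξ.1 ^ 2 + ξ.2 ^ 2)) := by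
    rw [← hmp.integrable_comp_emb hemb]
    refine (G.integrable_norm_sq_mul_norm volume).congr (Filter.Eventually.of_forall fun z ↦ ?_)
    simp only [Function.comp_apply, Complex.measurableEquivRealProd_apply, hG]
    rw [Complex.norm_eq_sqrt_sq_add_sq z]
  have hper : Function.Periodic (fun θ ↦ ∫ t : ℝ, ‖F θ t‖ ^ 2) (2 * π) := by
    intro θ
    simp [hF]
  have hshift := hper.intervalIntegral_add_eq 0 (-π)
  rw [zero_add, show -π + 2 * π = π by ring] at hshift
  rw [hshift, integral_eq_integral_integral_polar hint]
  congr 1 with θ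
  simp_rw [hF, hpolar]
  rw [integral_norm_sq_radial_fourierInv G (Complex.norm_exp_ofReal_mul_I θ)]
  refine setIntegral_congr_fun measurableSet_Ioi fun r hr ↦ ?_
  have : (r * cos θ) ^ 2 + (r * sin θ) ^ 2 = r ^ 2 := by
    linear_combination r ^ 2 * cos_sq_add_sin_sq θ
  simp only [this, Real.sqrt_sq (le_of_lt (Set.mem_Ioi.1 hr))]
end

section
/- Let f : ℝ² → ℂ be a Schwartz function, let u(x, y) = ∫_{ℝ²} e^{2πi x·ξ} e^{−2π|ξ| y} f̂(ξ) dξ for x ∈ ℝ² and y > 0, and for θ ∈ ℝ let F_θ(z) = ∫_0^∞ e^{2πirz} f̂(r θ⃗) r dr for Im z > 0, where θ⃗ = (cos θ, sin θ) and f̂(ξ) = ∫_{ℝ²} f(x) e^{−2πi x·ξ} dx. Then for every x ∈ ℝ² and y > 0, u(x, y) = ∫_0^{2π} F_θ(x·θ⃗ + i y) dθ; that is, the harmonic extension of f is the superposition over directions θ of functions holomorphic in the variable x·θ⃗ + iy. -/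
open MeasureTheory Real

/-- Polar coordinates, with the angular integral taken over `[0, 2π]` and outermost. -/
theorem integral_eq_intervalIntegral_integral_polar (G : ℝ × ℝ → ℂ)
    (hint : IntegrableOn (fun p : ℝ × ℝ => p.1 • G (polarCoord.symm p)) polarCoord.target) :
    ∫ ξ, G ξ = ∫ θ in (0 : ℝ)..(2 * π), ∫ r in Set.Ioi (0 : ℝ),
      r • G (r * Real.cos θ, r * Real.sin θ) := by
  rw [← integral_comp_polarCoord_symm]
  have hper : Function.Periodic (fun θ : ℝ => ∫ r in Set.Ioi (0 : ℝ),
      r • G (r * Real.cos θ, r * Real.sin θ)) (2 * π) := by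
    intro θ
    simp only [Real.cos_add_two_pi, Real.sin_add_two_pi]
  have h := hper.intervalIntegral_add_eq 0 (-π)
  rw [zero_add, show -π + 2 * π = π by ring] at h
  rw [h, intervalIntegral.integral_of_le (by linarith [Real.pi_pos]), integral_Ioc_eq_integral_Ioo]
  rw [polarCoord_target, Measure.volume_eq_prod] at hint ⊢
  rw [IntegrableOn, ← Measure.prod_restrict] at hint
  rw [← Measure.prod_restrict, integral_prod_symm _ hint]
  simp only [polarCoord_symm_apply]

/-- A continuous function dominated by a decaying exponential of the radius is integrable
in polar coordinates. -/
theorem integrableOn_polarCoord_of_norm_le_exp (G : ℝ × ℝ → ℂ) (hG : Continuous G) {C b : ℝ}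
    (hb : 0 < b) (hbound : ∀ ξ, ‖G ξ‖ ≤ C * Real.exp (-b * Real.sqrt (ξ.1 ^ 2 + ξ.2 ^ 2))) :
    IntegrableOn (fun p : ℝ × ℝ => p.1 • G (polarCoord.symm p)) polarCoord.target := by
  have hexp : IntegrableOn (fun r : ℝ => r * Real.exp (-b * r)) (Set.Ioi 0) := by
    simpa using integrableOn_rpow_mul_exp_neg_mul_rpow (s := 1) (p := 1) (by norm_num) one_pos hb
  have hone : IntegrableOn (fun _ : ℝ => C) (Set.Ioo (-π) π) := by simp
  have hprod := Integrable.mul_prod hexp hone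
  rw [Measure.prod_restrict, ← Measure.volume_eq_prod, ← polarCoord_target] at hprod
  refine Integrable.mono' hprod ?_ ?_
  · exact (continuous_fst.smul (hG.comp continuous_polarCoord_symm)).aestronglyMeasurable
  · refine (ae_restrict_iff' polarCoord.open_target.measurableSet).2 (ae_of_all _ fun p hp => ?_)
    have hr : 0 < p.1 := by
      rw [polarCoord_target] at hp
      exact hp.1
    have hsqrt : Real.sqrt ((p.1 * Real.cos p.2) ^ 2 + (p.1 * Real.sin p.2) ^ 2) = p.1 := by
      rw [mul_pow, mul_pow, ← mul_add, Real.cos_sq_add_sin_sq, mul_one, Real.sqrt_sq hr.le]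
    have h := hbound (polarCoord.symm p)
    simp only [polarCoord_symm_apply, hsqrt] at h
    rw [norm_smul, Real.norm_of_nonneg hr.le, mul_assoc, mul_comm (Real.exp _)]
    simpa only [polarCoord_symm_apply] using mul_le_mul_of_nonneg_left h hr.le

theorem norm_exp_neg_two_pi_I_mul (t : ℝ) :
    ‖Complex.exp (-2 * π * Complex.I * (t : ℂ))‖ = 1 := by
  rw [show -2 * π * Complex.I * (t : ℂ) = ((-2 * π * t : ℝ) : ℂ) * Complex.I by push_cast; ring]
  exact Complex.norm_exp_ofReal_mul_I _

theorem norm_exp_two_pi_I_mul (t : ℝ) :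
    ‖Complex.exp (2 * π * Complex.I * (t : ℂ))‖ = 1 := by
  rw [show 2 * π * Complex.I * (t : ℂ) = ((2 * π * t : ℝ) : ℂ) * Complex.I by push_cast; ring]
  exact Complex.norm_exp_ofReal_mul_I _

theorem norm_fourier_integral_le (f : ℝ × ℝ → ℂ) (ξ : ℝ × ℝ) :
    ‖∫ x : ℝ × ℝ, f x *
      Complex.exp (-2 * π * Complex.I * ((x.1 * ξ.1 + x.2 * ξ.2 : ℝ) : ℂ))‖ ≤ ∫ x, ‖f x‖ := by
  refine (norm_integral_le_integral_norm _).trans_eq ?_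
  simp only [norm_mul, norm_exp_neg_two_pi_I_mul, mul_one]

theorem continuous_fourier_integral {f : ℝ × ℝ → ℂ} (hf : Integrable f) :
    Continuous fun ξ : ℝ × ℝ => ∫ x : ℝ × ℝ, f x *
      Complex.exp (-2 * π * Complex.I * ((x.1 * ξ.1 + x.2 * ξ.2 : ℝ) : ℂ)) := by
  refine continuous_of_dominated (bound := fun x => ‖f x‖) (fun ξ => ?_) (fun ξ => ?_) hf.norm ?_
  · exact hf.aestronglyMeasurable.mul (by fun_prop : Continuous _).aestronglyMeasurable
  · refine ae_of_all _ fun x => ?_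
    rw [norm_mul, norm_exp_neg_two_pi_I_mul, mul_one]
  · exact ae_of_all _ fun x => by fun_prop

/-- The harmonic extension of a Schwartz function `f` on `ℝ²` is the
superposition over directions `θ` of the `θ`-holomorphic functions `F_θ`:
`u(x,y) = ∫_0^{2π} F_θ(x·θ⃗ + iy) dθ` for all `x ∈ ℝ²`, `y > 0`. -/
theorem harmonic_extension_superposition
    (f : SchwartzMap (ℝ × ℝ) ℂ)
    (hatf : ℝ × ℝ → ℂ)
    (hhat : ∀ ξ : ℝ × ℝ, hatf ξ = ∫ x : ℝ × ℝ, f x *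
      Complex.exp (-2 * π * Complex.I * ((x.1 * ξ.1 + x.2 * ξ.2 : ℝ) : ℂ)))
    (u : ℝ × ℝ → ℝ → ℂ)
    (hu : ∀ (x : ℝ × ℝ) (y : ℝ), u x y = ∫ ξ : ℝ × ℝ,
      Complex.exp (2 * π * Complex.I * ((x.1 * ξ.1 + x.2 * ξ.2 : ℝ) : ℂ)) *
        Complex.exp (-2 * π * (Real.sqrt (ξ.1 ^ 2 + ξ.2 ^ 2) : ℂ) * (y : ℂ)) * hatf ξ)
    (F : ℝ → ℂ → ℂ)
    (hF : ∀ (θ : ℝ) (z : ℂ), F θ z = ∫ r in Set.Ioi (0 : ℝ),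
      Complex.exp (2 * π * Complex.I * r * z) *
        hatf (r * Real.cos θ, r * Real.sin θ) * (r : ℂ)) :
    ∀ (x : ℝ × ℝ) (y : ℝ), 0 < y →
      u x y = ∫ θ in (0 : ℝ)..(2 * π),
        F θ (((x.1 * Real.cos θ + x.2 * Real.sin θ : ℝ) : ℂ) + (y : ℂ) * Complex.I) := by
  intro x y hy
  have hf : Integrable f := f.integrable
  have hcont : Continuous hatf := by
    rw [funext hhat]
    exact continuous_fourier_integral hf
  have hbd : ∀ ξ, ‖hatf ξ‖ ≤ ∫ x, ‖f x‖ := fun ξ => by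
    rw [hhat]
    exact norm_fourier_integral_le f ξ
  have hint := integrableOn_polarCoord_of_norm_le_exp (fun ξ : ℝ × ℝ =>
      Complex.exp (2 * π * Complex.I * ((x.1 * ξ.1 + x.2 * ξ.2 : ℝ) : ℂ)) *
        Complex.exp (-2 * π * (Real.sqrt (ξ.1 ^ 2 + ξ.2 ^ 2) : ℂ) * (y : ℂ)) * hatf ξ)
    (by fun_prop) (C := ∫ x, ‖f x‖) (b := 2 * π * y) (by positivity) fun ξ => by
    have hexp : -2 * π * (Real.sqrt (ξ.1 ^ 2 + ξ.2 ^ 2) : ℂ) * (y : ℂ) =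
        ((-(2 * π * y) * Real.sqrt (ξ.1 ^ 2 + ξ.2 ^ 2) : ℝ) : ℂ) := by
      push_cast
      ring
    rw [norm_mul, norm_mul, norm_exp_two_pi_I_mul, one_mul, hexp, Complex.norm_exp_ofReal,
      mul_comm]
    exact mul_le_mul_of_nonneg_right (hbd ξ) (Real.exp_pos _).le
  rw [hu, integral_eq_intervalIntegral_integral_polar _ hint]
  refine intervalIntegral.integral_congr fun θ _ => ?_
  simp only [hF]
  refine setIntegral_congr_fun measurableSet_Ioi fun r hr => ?_
  have hr : 0 < r := hr
  have hsqrt : Real.sqrt ((r * Real.cos θ) ^ 2 + (r * Real.sin θ) ^ 2) = r := by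
    rw [mul_pow, mul_pow, ← mul_add, Real.cos_sq_add_sin_sq, mul_one, Real.sqrt_sq hr.le]
  simp only [hsqrt, Complex.real_smul]
  rw [← Complex.exp_add, mul_comm (r : ℂ)]
  congr 3
  push_cast
  linear_combination (-2 * π * r * y : ℂ) * Complex.I_sq
end
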